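/- Assume conditions (A1)–(A4). For every p ∈ ℕ ∪ {∞} (with a ∧ ∞ = a), every d ∈ [0,∞), and each i ∈ {0,1}, the functions X → [0,1] defined by x ↦ E_x[ | liminf_{n→∞} (1/n) Σ_{k=1}^n (Z_{2k+i}(g)² ∧ p) − d | ∧ 1 ] and x ↦ E_x[ | limsup_{n→∞} (1/n) Σ_{k=1}^n (Z_{2k+i}(g)² ∧ p) − d | ∧ 1 ] are continuous on X. -/

import Mathlib

open MeasureTheory Filter Set
open scoped ENNReal Topology NNReal

noncomputable section

variable {X : Type*} [MetricSpace X] [CompleteSpace X] [SecondCountableTopology X]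
  [MeasurableSpace X] [BorelSpace X]

/-- Action of a transition kernel family on measures: `ν ↦ ν P_t`. -/
def measAct (P : ℝ → X → Measure X) (t : ℝ) (ν : Measure X) : Measure X :=
  ν.bind (P t)

/-- Dual action of the semigroup on functions: `f ↦ P_t f`. -/
def funAct (P : ℝ → X → Measure X) (t : ℝ) (f : X → ℝ) (x : X) : ℝ :=
  ∫ y, f y ∂(P t x)

/-- A Borel (probability) measure has a finite first moment. -/
def FiniteFirstMoment (ν : Measure X) : Prop :=
  ∀ x₀ : X, Integrable (fun x => dist x₀ x) ν

/-- The Wasserstein (Kantorovich–Rubinstein) distance `d_W`. -/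
def wassDist (μ ν : Measure X) : ℝ :=
  sSup {r | ∃ f : X → ℝ, LipschitzWith 1 f ∧ r = |(∫ x, f x ∂μ) - ∫ x, f x ∂ν|}

/-- A Markov semigroup `{P_t}_{t ≥ 0}` of probability kernels on `X`. -/
structure IsMarkovSemigroup (P : ℝ → X → Measure X) : Prop where
  prob : ∀ t, 0 ≤ t → ∀ x, IsProbabilityMeasure (P t x)
  jointMeas : ∀ A : Set X, MeasurableSet A → Measurable fun p : ℝ × X => P p.1 p.2 A
  init : ∀ x, P 0 x = Measure.dirac x
  chapman : ∀ s t, 0 ≤ s → 0 ≤ t → ∀ x, P (s + t) x = (P s x).bind (P t)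

/-- Condition (A1): stochastic continuity of the semigroup. -/
def CondA1 (P : ℝ → X → Measure X) : Prop :=
  ∀ f : X → ℝ, Continuous f → (∃ C, ∀ x, |f x| ≤ C) →
    ∀ x : X, Tendsto (fun t => funAct P t f x) (𝓝[>] (0 : ℝ)) (𝓝 (f x))

/-- Condition (A2): the Feller property. -/
def CondA2 (P : ℝ → X → Measure X) : Prop :=
  ∀ f : X → ℝ, Continuous f → (∃ C, ∀ x, |f x| ≤ C) → ∀ t, 0 ≤ t →
    Continuous (funAct P t f) ∧ ∃ C, ∀ x, |funAct P t f x| ≤ C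

/-- Condition (A3): preservation of finite first moments and exponential
contractivity in the Wasserstein distance, with rate `γ`. -/
def CondA3 (P : ℝ → X → Measure X) (γ : ℝ) : Prop :=
  (∀ ν : Measure X, IsProbabilityMeasure ν → FiniteFirstMoment ν →
    ∀ t, 0 < t → FiniteFirstMoment (measAct P t ν)) ∧
  0 < γ ∧
  ∀ t, 0 ≤ t → ∀ x y : X,
    wassDist (P t x) (P t y) ≤ Real.exp (-γ * t) * dist x y

/-- Condition (A4): a uniform-in-time moment bound of order `ζ > 2` for the initial
distribution `μ`, along the semigroup. -/
def CondA4 (P : ℝ → X → Measure X) (μ : Measure X) (x₀ : X) (ζ : ℝ) : Prop :=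
  2 < ζ ∧ ∃ M : ℝ, ∀ t, 0 ≤ t →
    (∫⁻ x, ENNReal.ofReal (dist x₀ x ^ ζ) ∂(measAct P t μ)) ≤ ENNReal.ofReal M

variable {Ω : Type*} [MeasurableSpace Ω]

/-- The natural filtration of the process `Φ`. -/
def natFiltration (Φ : ℝ → Ω → X) (s : ℝ) : MeasurableSpace Ω :=
  ⨆ u ∈ Set.Icc (0 : ℝ) s, MeasurableSpace.comap (Φ u) inferInstance

/-- A (progressively measurable) time-homogeneous Markov process with state space `X`,
transition semigroup `P` and initial distribution `μ`, realized on `(Ω, ℙ)`. -/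
structure IsMarkovProcess (P : ℝ → X → Measure X) (Φ : ℝ → Ω → X)
    (ℙ : Measure Ω) (μ : Measure X) : Prop where
  jointMeas : Measurable fun p : ℝ × Ω => Φ p.1 p.2
  init : ℙ.map (Φ 0) = μ
  law : ∀ t, 0 ≤ t → ℙ.map (Φ t) = measAct P t μ
  markov : ∀ f : X → ℝ, Measurable f → (∃ C, ∀ x, |f x| ≤ C) →
    ∀ s t : ℝ, 0 ≤ s → 0 ≤ t →
      (fun ω => funAct P t f (Φ s ω)) =ᵐ[ℙ]
        ℙ[(fun ω => f (Φ (s + t) ω)) | natFiltration Φ s]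

/-- A Markov process together with a measurable family of laws `{ℙ_x}_{x ∈ X}`,
with `ℙ_x(Φ_0 = x) = 1`. -/
structure IsMarkovFamily (P : ℝ → X → Measure X) (Φ : ℝ → Ω → X)
    (ℙ : X → Measure Ω) : Prop where
  prob : ∀ x, IsProbabilityMeasure (ℙ x)
  jointMeas : Measurable fun p : ℝ × Ω => Φ p.1 p.2
  measFam : ∀ s : Set Ω, MeasurableSet s → Measurable fun x => ℙ x s
  start : ∀ x, (ℙ x) {ω | Φ 0 ω = x} = 1
  law : ∀ x, ∀ t, 0 ≤ t → (ℙ x).map (Φ t) = P t x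
  markov : ∀ x : X, ∀ f : X → ℝ, Measurable f → (∃ C, ∀ z, |f z| ≤ C) →
    ∀ s t : ℝ, 0 ≤ s → 0 ≤ t →
      (fun ω => funAct P t f (Φ s ω)) =ᵐ[ℙ x]
        (ℙ x)[(fun ω => f (Φ (s + t) ω)) | natFiltration Φ s]

/-- The corrector function `χ_g(x) = ∫_0^∞ (P_t g)(x) dt`. -/
def corrector (P : ℝ → X → Measure X) (g : X → ℝ) (x : X) : ℝ :=
  ∫ t in Set.Ioi (0 : ℝ), funAct P t g x

/-- The additive functional `I_t(g) = ∫_0^t g(Φ_s) ds`. -/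
def addFun (g : X → ℝ) (Φ : ℝ → Ω → X) (t : ℝ) (ω : Ω) : ℝ :=
  ∫ s in (0 : ℝ)..t, g (Φ s ω)

/-- The martingale part `M_t(g) = χ_g(Φ_t) - χ_g(Φ_0) + I_t(g)`. -/
def mart (P : ℝ → X → Measure X) (g : X → ℝ) (Φ : ℝ → Ω → X) (t : ℝ) (ω : Ω) : ℝ :=
  corrector P g (Φ t ω) - corrector P g (Φ 0 ω) + addFun g Φ t ω

/-- The martingale increments `Z_n(g) = M_n(g) - M_{n-1}(g)`. -/
def incr (P : ℝ → X → Measure X) (g : X → ℝ) (Φ : ℝ → Ω → X) (n : ℕ) (ω : Ω) : ℝ :=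
  mart P g Φ (n : ℝ) ω - mart P g Φ ((n : ℝ) - 1) ω

/-- Truncation `a ∧ p` for `p ∈ ℕ ∪ {∞}`, with the convention `a ∧ ∞ = a`. -/
def truncMin (a : ℝ) (p : ℕ∞) : ℝ :=
  if p = ⊤ then a else min a (p.toNat : ℝ)

set_option linter.all false

/-! ### Deterministic estimates for root mean squares -/

/-- Square root of the truncation of `z ^ 2`. -/
def cutS (p : ℕ∞) (z : ℝ) : ℝ := if p = ⊤ then |z| else min |z| (√(p.toNat : ℝ))

lemma cutS_sq (p : ℕ∞) (z : ℝ) : cutS p z ^ 2 = truncMin (z ^ 2) p := by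
  unfold cutS truncMin
  split_ifs with h
  · exact sq_abs z
  · have h0 : (0:ℝ) ≤ p.toNat := Nat.cast_nonneg _
    rcases le_total |z| (√(p.toNat : ℝ)) with h1 | h1
    · rw [min_eq_left h1, sq_abs, min_eq_left]
      rw [← sq_abs]
      exact (Real.le_sqrt (abs_nonneg _) h0).1 h1
    · rw [min_eq_right h1, Real.sq_sqrt h0, min_eq_right]
      rw [← sq_abs]
      exact (Real.sqrt_le_left (abs_nonneg _)).1 h1

lemma cutS_lip (p : ℕ∞) (z z' : ℝ) : |cutS p z - cutS p z'| ≤ |z - z'| := by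
  unfold cutS
  split_ifs with h
  · exact abs_abs_sub_abs_le _ _
  · exact (abs_min_sub_min_le_max _ _ _ _).trans (by simpa using abs_abs_sub_abs_le z z')

lemma sqrt_add_sq_le (x a y b : ℝ) :
    √(x ^ 2 + a ^ 2) ≤ √(y ^ 2 + b ^ 2) + (|x - y| + |a - b|) := by
  rw [Real.sqrt_le_left (by positivity)]
  have hr : √(y ^ 2 + b ^ 2) ^ 2 = y ^ 2 + b ^ 2 := Real.sq_sqrt (by positivity)
  have h1 : |y| ≤ √(y ^ 2 + b ^ 2) := Real.abs_le_sqrt (by nlinarith [sq_nonneg b])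
  have h2 : |b| ≤ √(y ^ 2 + b ^ 2) := Real.abs_le_sqrt (by nlinarith [sq_nonneg y])
  have hx : x ^ 2 ≤ (|y| + |x - y|) ^ 2 := by
    rw [← sq_abs x]
    gcongr
    have := abs_add_le y (x - y)
    simpa using this
  have ha : a ^ 2 ≤ (|b| + |a - b|) ^ 2 := by
    rw [← sq_abs a]
    gcongr
    have := abs_add_le b (a - b)
    simpa using this
  have e1 := mul_le_mul_of_nonneg_right h1 (abs_nonneg (x - y))
  have e2 := mul_le_mul_of_nonneg_right h2 (abs_nonneg (a - b))
  have e3 := mul_nonneg (abs_nonneg (x - y)) (abs_nonneg (a - b))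
  nlinarith [sq_abs y, sq_abs b]

lemma sqrt_sum_sq_le {ι : Type*} (s : Finset ι) (a b : ι → ℝ) :
    √(∑ k ∈ s, a k ^ 2) ≤ √(∑ k ∈ s, b k ^ 2) + ∑ k ∈ s, |a k - b k| := by
  classical
  induction s using Finset.induction_on with
  | empty => simp
  | insert i s hi ih =>
    rw [Finset.sum_insert hi, Finset.sum_insert hi, Finset.sum_insert hi]
    have hA : 0 ≤ ∑ k ∈ s, a k ^ 2 := Finset.sum_nonneg fun _ _ => sq_nonneg _
    have hB : 0 ≤ ∑ k ∈ s, b k ^ 2 := Finset.sum_nonneg fun _ _ => sq_nonneg _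
    rw [← Real.sq_sqrt hA, ← Real.sq_sqrt hB]
    rcases le_total (√(∑ k ∈ s, b k ^ 2)) (√(∑ k ∈ s, a k ^ 2)) with h | h
    · have := sqrt_add_sq_le (a i) (√(∑ k ∈ s, a k ^ 2)) (b i) (√(∑ k ∈ s, b k ^ 2))
      rw [abs_of_nonneg (sub_nonneg.2 h)] at this
      linarith
    · have := sqrt_add_sq_le (a i) (√(∑ k ∈ s, a k ^ 2)) (b i) (√(∑ k ∈ s, a k ^ 2))
      have h3 : √(b i ^ 2 + √(∑ k ∈ s, a k ^ 2) ^ 2) ≤ √(b i ^ 2 + √(∑ k ∈ s, b k ^ 2) ^ 2) := by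
        gcongr
      have h4 : 0 ≤ ∑ k ∈ s, |a k - b k| := Finset.sum_nonneg fun _ _ => abs_nonneg _
      simp only [sub_self, abs_zero, add_zero] at this
      linarith

/-- The truncated average of squares. -/
def avg (p : ℕ∞) (j : ℕ) (z : ℕ → ℝ) : ℝ :=
  (1 / (j : ℝ)) * ∑ k ∈ Finset.Icc 1 j, truncMin ((z k) ^ 2) p

lemma avg_nonneg (p : ℕ∞) (j : ℕ) (z : ℕ → ℝ) : 0 ≤ avg p j z := by
  unfold avg
  refine mul_nonneg (by positivity) (Finset.sum_nonneg fun k _ => ?_)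
  rw [← cutS_sq]; positivity

lemma sqrt_avg_le (p : ℕ∞) {n j : ℕ} (hn : 1 ≤ n) (hj : n ≤ j) (z z' : ℕ → ℝ) :
    √(avg p j z) ≤ √(avg p j z') + (1 / √(n : ℝ)) * ∑ k ∈ Finset.Icc 1 j, |z k - z' k| := by
  unfold avg
  simp_rw [← cutS_sq]
  have hj0 : (0:ℝ) ≤ 1 / (j:ℝ) := by positivity
  rw [Real.sqrt_mul hj0, Real.sqrt_mul hj0]
  have hn0 : (0:ℝ) < n := by exact_mod_cast hn
  have h1 : √(1 / (j:ℝ)) ≤ 1 / √(n : ℝ) := by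
    rw [Real.sqrt_div zero_le_one, Real.sqrt_one]
    gcongr
  have h2 := sqrt_sum_sq_le (Finset.Icc 1 j) (fun k => cutS p (z k)) (fun k => cutS p (z' k))
  have h3 : ∑ k ∈ Finset.Icc 1 j, |cutS p (z k) - cutS p (z' k)|
      ≤ ∑ k ∈ Finset.Icc 1 j, |z k - z' k| := Finset.sum_le_sum fun k _ => cutS_lip _ _ _
  have h4 : 0 ≤ ∑ k ∈ Finset.Icc 1 j, |z k - z' k| := Finset.sum_nonneg fun _ _ => abs_nonneg _
  calc _ ≤ √(1 / (j:ℝ)) * (√(∑ k ∈ Finset.Icc 1 j, cutS p (z' k) ^ 2)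
        + ∑ k ∈ Finset.Icc 1 j, |z k - z' k|) := by
        gcongr; linarith
    _ ≤ _ := by
        rw [mul_add]; gcongr

/-- Compactification map `a ↦ √a / (1 + √a)`. -/
def cpt (a : ℝ) : ℝ := √a / (1 + √a)

lemma cpt_nonneg (a : ℝ) : 0 ≤ cpt a := by unfold cpt; positivity
lemma cpt_lt_one (a : ℝ) : cpt a < 1 := by
  unfold cpt; rw [div_lt_one (by positivity)]; linarith
lemma cpt_eq (a : ℝ) : cpt a = 1 - 1 / (1 + √a) := by
  have : 0 < 1 + √a := by positivity
  unfold cpt; field_simp; ring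
lemma cpt_mono : Monotone cpt := by
  intro a b h
  rw [cpt_eq, cpt_eq]
  have := Real.sqrt_le_sqrt h
  gcongr
lemma cpt_cont : Continuous cpt := by
  unfold cpt
  exact Real.continuous_sqrt.div (by fun_prop) fun a => by positivity

/-- Left inverse of `cpt` on the nonnegative reals, with value `0` at `1`. -/
def unc (u : ℝ) : ℝ := (u / (1 - u)) ^ 2

lemma unc_one : unc 1 = 0 := by simp [unc]
lemma unc_cpt {a : ℝ} (ha : 0 ≤ a) : unc (cpt a) = a := by
  have h : 0 < 1 + √a := by positivity
  have : cpt a / (1 - cpt a) = √a := by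
    unfold cpt
    have h2 : 1 - √a / (1 + √a) = 1 / (1 + √a) := by field_simp; ring
    rw [h2]; field_simp
  unfold unc
  rw [this, Real.sq_sqrt ha]

lemma cpt_le {a b t : ℝ} (ht : 0 ≤ t) (h : √a ≤ √b + t) : cpt a ≤ cpt b + t := by
  have ha : 0 < 1 + √a := by positivity
  have hb : 0 ≤ √b := by positivity
  have h1 : cpt a ≤ (√b + t) / (1 + (√b + t)) := by
    unfold cpt
    rw [div_le_div_iff₀ ha (by positivity)]
    nlinarith
  refine h1.trans ?_
  unfold cpt
  rw [div_add' _ _ _ (by positivity), div_le_div_iff₀ (by positivity) (by positivity)]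
  have := mul_nonneg hb ht
  have := mul_nonneg this hb
  have := mul_nonneg ht ht
  have := mul_nonneg this hb
  nlinarith

lemma abs_cpt_avg_sub_le (p : ℕ∞) {n j : ℕ} (hn : 1 ≤ n) (hj : n ≤ j) (z z' : ℕ → ℝ) :
    |cpt (avg p j z) - cpt (avg p j z')| ≤
      (1 / √(n : ℝ)) * ∑ k ∈ Finset.Icc 1 j, |z k - z' k| := by
  have h4 : 0 ≤ (1 / √(n : ℝ)) * ∑ k ∈ Finset.Icc 1 j, |z k - z' k| :=
    mul_nonneg (by positivity) (Finset.sum_nonneg fun _ _ => abs_nonneg _)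
  have h1 := cpt_le h4 (sqrt_avg_le p hn hj z z')
  have h2 := cpt_le (by simpa only [abs_sub_comm] using h4) (sqrt_avg_le p hn hj z' z)
  simp only [abs_sub_comm (z' _)] at h2
  rw [abs_le]; constructor <;> linarith

/-- Finite-window infimum of the (signed) compactified averages. -/
def win (c : ℝ) (p : ℕ∞) (n m : ℕ) (z : ℕ → ℝ) : ℝ :=
  (Finset.range (m + 1)).inf' Finset.nonempty_range_add_one
    (fun j => c * cpt (avg p (n + j) z))

lemma win_lip (c : ℝ) (p : ℕ∞) {n : ℕ} (m : ℕ) (hn : 1 ≤ n) (z z' : ℕ → ℝ) :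
    |win c p n m z - win c p n m z'| ≤
      |c| * ((1 / √(n : ℝ)) * ∑ k ∈ Finset.Icc 1 (n + m), |z k - z' k|) := by
  have key : ∀ z z' : ℕ → ℝ, win c p n m z' ≤ win c p n m z +
      |c| * ((1 / √(n : ℝ)) * ∑ k ∈ Finset.Icc 1 (n + m), |z k - z' k|) := by
    intro z z'
    rw [← sub_le_iff_le_add]
    unfold win
    refine Finset.le_inf' _ _ fun j hj => ?_
    rw [sub_le_iff_le_add]
    refine (Finset.inf'_le _ hj).trans ?_
    have h1 := abs_cpt_avg_sub_le p hn (Nat.le_add_right n j) z z'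
    have h2 : ∑ k ∈ Finset.Icc 1 (n + j), |z k - z' k| ≤
        ∑ k ∈ Finset.Icc 1 (n + m), |z k - z' k| := by
      refine Finset.sum_le_sum_of_subset_of_nonneg ?_ fun _ _ _ => abs_nonneg _
      apply Finset.Icc_subset_Icc le_rfl
      have := Finset.mem_range.1 hj
      omega
    have h3 : |c * cpt (avg p (n + j) z') - c * cpt (avg p (n + j) z)| ≤
        |c| * ((1 / √(n : ℝ)) * ∑ k ∈ Finset.Icc 1 (n + m), |z k - z' k|) := by
      rw [← mul_sub, abs_mul, abs_sub_comm]
      gcongr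
      refine h1.trans ?_
      gcongr
    have := (abs_le.1 h3).2
    linarith
  have h1 := key z z'
  have h2 := key z' z
  simp only [abs_sub_comm (z' _)] at h2
  rw [abs_le]; constructor <;> linarith

lemma tendsto_inf'_range (v : ℕ → ℝ) (C : ℝ) (hv : ∀ j, C ≤ v j) :
    Tendsto (fun m : ℕ => (Finset.range (m + 1)).inf' Finset.nonempty_range_add_one v)
      atTop (𝓝 (⨅ j, v j)) := by
  have hb : BddBelow (range v) := ⟨C, by rintro _ ⟨j, rfl⟩; exact hv j⟩
  have hanti : Antitone
      (fun m : ℕ => (Finset.range (m + 1)).inf' Finset.nonempty_range_add_one v) := by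
    intro a b hab
    exact Finset.inf'_mono _ (Finset.range_mono (by omega)) _
  have hbb : BddBelow (range
      (fun m : ℕ => (Finset.range (m + 1)).inf' Finset.nonempty_range_add_one v)) :=
    ⟨C, by rintro _ ⟨j, rfl⟩; exact Finset.le_inf' _ _ fun j _ => hv j⟩
  have h := tendsto_atTop_ciInf hanti hbb
  convert h using 2
  apply le_antisymm
  · exact le_ciInf fun m => Finset.le_inf' _ _ fun j _ => ciInf_le hb j
  · exact le_ciInf fun j => (ciInf_le hbb j).trans (Finset.inf'_le _ (by simp))

lemma tendsto_iInf_shift (v : ℕ → ℝ) (C : ℝ) (hv : ∀ j, |v j| ≤ C) :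
    Tendsto (fun n : ℕ => ⨅ j, v (n + j)) atTop (𝓝 (liminf v atTop)) := by
  have hb : ∀ n, BddBelow (range fun j => v (n + j)) := fun n =>
    ⟨-C, by rintro _ ⟨j, rfl⟩; exact (abs_le.1 (hv _)).1⟩
  have hmono : Monotone (fun n : ℕ => ⨅ j, v (n + j)) := by
    intro a b hab
    refine le_ciInf fun j => ?_
    refine (ciInf_le (hb a) (b - a + j)).trans (le_of_eq ?_)
    congr 1; omega
  have hbb : BddAbove (range fun n : ℕ => ⨅ j, v (n + j)) :=
    ⟨C, by rintro _ ⟨n, rfl⟩; exact (ciInf_le (hb n) 0).trans (abs_le.1 (hv _)).2⟩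
  have hbd : IsBoundedUnder (· ≥ ·) atTop v :=
    isBoundedUnder_of ⟨-C, fun j => (abs_le.1 (hv j)).1⟩
  have hcob : IsCoboundedUnder (· ≥ ·) atTop v :=
    (isBoundedUnder_of ⟨C, fun j => (abs_le.1 (hv j)).2⟩ :
      IsBoundedUnder (· ≤ ·) atTop v).isCoboundedUnder_ge
  convert tendsto_atTop_ciSup hmono hbb using 2
  apply le_antisymm
  · refine le_of_forall_lt fun a ha => ?_
    obtain ⟨b, hab, hb'⟩ := exists_between ha
    have := eventually_lt_of_lt_liminf hb' hbd
    obtain ⟨n, hn⟩ := eventually_atTop.1 this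
    refine hab.trans_le (le_trans ?_ (le_ciSup hbb n))
    exact le_ciInf fun j => (hn _ (by omega)).le
  · refine ciSup_le fun n => le_liminf_of_le hcob ?_
    filter_upwards [eventually_ge_atTop n] with j hj
    refine (ciInf_le (hb n) (j - n)).trans (le_of_eq ?_)
    congr 1; omega

lemma unc_liminf_cpt (a : ℕ → ℝ) (ha : ∀ n, 0 ≤ a n) :
    unc (liminf (fun n => cpt (a n)) atTop) = liminf a atTop := by
  have hbd : IsBoundedUnder (· ≥ ·) atTop a := isBoundedUnder_of ⟨0, ha⟩
  by_cases hc : ∃ C, ∃ᶠ n in atTop, a n ≤ C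
  · obtain ⟨C, hC⟩ := hc
    have hcob : IsCoboundedUnder (· ≥ ·) atTop a := IsCobounded.of_frequently_le hC
    have h := cpt_mono.map_liminf_of_continuousAt (F := atTop) a cpt_cont.continuousAt hcob hbd
    have h' : cpt (liminf a atTop) = liminf (fun n => cpt (a n)) atTop := h
    rw [← h', unc_cpt]
    exact le_liminf_of_le hcob (Eventually.of_forall ha)
  · simp only [not_exists, not_frequently, not_le] at hc
    have hT : Tendsto a atTop atTop := tendsto_atTop.2 fun C => (hc C).mono fun _ h => h.le
    have h1 : Tendsto (fun n => cpt (a n)) atTop (𝓝 1) := by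
      simp_rw [cpt_eq]
      have : Tendsto (fun n => 1 / (1 + √(a n))) atTop (𝓝 0) := by
        simp_rw [one_div]
        exact (tendsto_atTop_add_const_left _ 1 (Real.tendsto_sqrt_atTop.comp hT)).inv_tendsto_atTop
      simpa using tendsto_const_nhds.sub this
    rw [h1.liminf_eq, unc_one, liminf_eq]
    have : {b | ∀ᶠ n in atTop, b ≤ a n} = univ := by
      ext b; simpa using (hc b).mono fun _ h => h.le
    rw [this, Real.sSup_univ]

lemma unc_limsup_cpt (a : ℕ → ℝ) (ha : ∀ n, 0 ≤ a n) :
    unc (limsup (fun n => cpt (a n)) atTop) = limsup a atTop := by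
  have hbd : IsBoundedUnder (· ≥ ·) atTop a := isBoundedUnder_of ⟨0, ha⟩
  have hcob : IsCoboundedUnder (· ≤ ·) atTop a := hbd.isCoboundedUnder_le
  by_cases hc : IsBoundedUnder (· ≤ ·) atTop a
  · have h := cpt_mono.map_limsup_of_continuousAt (F := atTop) a cpt_cont.continuousAt hc hcob
    have h' : cpt (limsup a atTop) = limsup (fun n => cpt (a n)) atTop := h
    rw [← h', unc_cpt]
    exact le_limsup_of_frequently_le (Eventually.of_forall ha).frequently hc
  · have hc' : ∀ C, ∃ᶠ n in atTop, C < a n := by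
      intro C hC
      exact hc ⟨C, by simpa using hC⟩
    have hE : {b | ∀ᶠ n in atTop, a n ≤ b} = ∅ := by
      ext b
      simp only [mem_ofPred_eq, mem_empty_iff_false, iff_false]
      intro h
      exact hc ⟨b, by simpa using h⟩
    have hub : IsBoundedUnder (· ≤ ·) atTop (fun n => cpt (a n)) :=
      isBoundedUnder_of ⟨1, fun n => (cpt_lt_one _).le⟩
    have hlb : IsBoundedUnder (· ≥ ·) atTop (fun n => cpt (a n)) :=
      isBoundedUnder_of ⟨0, fun n => cpt_nonneg _⟩
    have h1 : limsup (fun n => cpt (a n)) atTop = 1 := by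
      apply le_antisymm
      · exact limsup_le_of_le hlb.isCoboundedUnder_le
          (Eventually.of_forall fun n => (cpt_lt_one _).le)
      · have hl : Tendsto cpt atTop (𝓝 1) := by
          have e : cpt = fun a => 1 - 1 / (1 + √a) := funext cpt_eq
          rw [e]
          have : Tendsto (fun a => 1 / (1 + √a)) atTop (𝓝 0) := by
            simp_rw [one_div]
            exact (tendsto_atTop_add_const_left _ 1 Real.tendsto_sqrt_atTop).inv_tendsto_atTop
          simpa using tendsto_const_nhds.sub this
        refine le_of_tendsto hl (Eventually.of_forall fun C => ?_)
        exact le_limsup_of_frequently_le ((hc' C).mono fun n h => cpt_mono h.le) hub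
    rw [h1, unc_one, limsup_eq, hE, Real.sInf_empty]

lemma limsup_eq_neg_liminf_neg (v : ℕ → ℝ) (C : ℝ) (hv : ∀ j, |v j| ≤ C) :
    limsup v atTop = - liminf (fun n => (-1) * v n) atTop := by
  have hbd : IsBoundedUnder (· ≥ ·) atTop v :=
    isBoundedUnder_of ⟨-C, fun j => (abs_le.1 (hv j)).1⟩
  have hbd' : IsBoundedUnder (· ≤ ·) atTop v :=
    isBoundedUnder_of ⟨C, fun j => (abs_le.1 (hv j)).2⟩
  have hanti : Antitone (fun x : ℝ => (-1) * x) := fun a b h => by simpa using h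
  have h := hanti.map_limsup_of_continuousAt (F := atTop) v (by fun_prop) hbd'
    hbd.isCoboundedUnder_le
  have h' : (-1) * limsup v atTop = liminf (fun n => (-1) * v n) atTop := h
  rw [← h']; ring

/-! ### The semigroup: measurability and contraction -/

lemma measurable_P {P : ℝ → X → Measure X} (hP : IsMarkovSemigroup P) (t : ℝ) :
    Measurable (P t) := by
  refine Measure.measurable_of_measurable_coe _ fun A hA => ?_
  exact (hP.jointMeas A hA).comp (measurable_const.prodMk measurable_id)

/-- The transition probability at time `t ≥ 0` as a kernel. -/
def kerP {P : ℝ → X → Measure X} (hP : IsMarkovSemigroup P) (t : ℝ) :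
    ProbabilityTheory.Kernel X X := ⟨P t, measurable_P hP t⟩

lemma firstMoment_P {P : ℝ → X → Measure X} (hP : IsMarkovSemigroup P) {γ : ℝ}
    (hA3 : CondA3 P γ) {t : ℝ} (ht : 0 < t) (x : X) : FiniteFirstMoment (P t x) := by
  have h := hA3.1 (Measure.dirac x) inferInstance
    (fun x₀ => by
      have : Integrable (fun _ : X => dist x₀ x) (Measure.dirac x) := integrable_const _
      refine this.congr ?_
      rw [Filter.EventuallyEq, ae_dirac_iff]
      · exact measurableSet_eq_fun measurable_const (by fun_prop))
    t ht
  unfold measAct at h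
  rwa [Measure.dirac_bind (measurable_P hP t)] at h

lemma integrable_of_bdd {α : Type*} [MeasurableSpace α] {ν : Measure α} [IsFiniteMeasure ν]
    {f : α → ℝ} (hf : Measurable f) {C : ℝ} (hC : ∀ a, |f a| ≤ C) : Integrable f ν :=
  Integrable.of_bound hf.aestronglyMeasurable C (Eventually.of_forall hC)

/-- Contraction of the semigroup, dual form. -/
lemma funAct_lip {P : ℝ → X → Measure X} (hP : IsMarkovSemigroup P) {γ : ℝ}
    (hA3 : CondA3 P γ) {t : ℝ} (ht : 0 < t) {φ : X → ℝ} {L : ℝ} (hL : 0 ≤ L)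
    (hφ : ∀ a b, |φ a - φ b| ≤ L * dist a b) (x y : X) :
    |(∫ z, φ z ∂(P t x)) - ∫ z, φ z ∂(P t y)| ≤ L * (Real.exp (-γ * t) * dist x y) := by
  have := hP.prob t ht.le x
  have := hP.prob t ht.le y
  have hW := hA3.2.2 t ht.le x y
  have hbdd : BddAbove {r | ∃ f : X → ℝ, LipschitzWith 1 f ∧
      r = |(∫ x, f x ∂(P t x)) - ∫ x, f x ∂(P t y)|} := by
    refine ⟨(∫ z, dist x z ∂(P t x)) + ∫ z, dist x z ∂(P t y), ?_⟩
    rintro _ ⟨f, hf, rfl⟩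
    have hb : ∀ z, |f z - f x| ≤ dist x z := fun z => by
      have := hf.dist_le_mul z x
      rw [Real.dist_eq, dist_comm] at this
      simpa using this
    have hIntg : ∀ w : X, Integrable (fun z => f z - f x) (P t w) := fun w =>
      ((firstMoment_P hP hA3 ht w) x).mono'
        (hf.continuous.measurable.sub_const _).aestronglyMeasurable
        (Eventually.of_forall hb)
    have hsub : ∀ w : X, ∫ z, f z ∂(P t w) = (∫ z, (f z - f x) ∂(P t w)) + f x := fun w => by
      have := hP.prob t ht.le w
      have : ∫ z, f z ∂(P t w) = ∫ z, ((f z - f x) + f x) ∂(P t w) := by simp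
      rw [this, integral_add (hIntg w) (integrable_const _)]
      simp
    have hb2 : ∀ w : X, |∫ z, (f z - f x) ∂(P t w)| ≤ ∫ z, dist x z ∂(P t w) := fun w =>
      (abs_integral_le_integral_abs).trans
        (integral_mono (hIntg w).abs ((firstMoment_P hP hA3 ht w) x) hb)
    rw [hsub x, hsub y, add_sub_add_right_eq_sub]
    exact (abs_sub _ _).trans (add_le_add (hb2 x) (hb2 y))
  rcases hL.eq_or_lt with rfl | hL
  · have hc : ∀ a, φ a = φ x := fun a => by
      have := hφ a x
      simp only [zero_mul, abs_nonpos_iff, sub_eq_zero] at this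
      exact this
    simp [hc]
  · have hlip : LipschitzWith 1 (fun z => L⁻¹ * φ z) := by
      refine LipschitzWith.of_dist_le_mul fun a b => ?_
      rw [Real.dist_eq, ← mul_sub, abs_mul, abs_of_pos (inv_pos.2 hL)]
      have := mul_le_mul_of_nonneg_left (hφ a b) (inv_pos.2 hL).le
      rw [← mul_assoc, inv_mul_cancel₀ hL.ne'] at this
      simpa using this
    have h1 := (le_csSup hbdd ⟨_, hlip, rfl⟩).trans hW
    rw [integral_const_mul, integral_const_mul, ← mul_sub, abs_mul, abs_of_pos (inv_pos.2 hL)] at h1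
    have := mul_le_mul_of_nonneg_left h1 hL.le
    rw [← mul_assoc, mul_inv_cancel₀ hL.ne', one_mul] at this
    exact this

lemma measurable_funAct {P : ℝ → X → Measure X} (hP : IsMarkovSemigroup P)
    {g : X → ℝ} (hg : Measurable g) (x : X) :
    AEStronglyMeasurable (fun t => funAct P t g x) (volume.restrict (Set.Ioi (0:ℝ))) := by
  have hm : Measurable (fun t : ℝ => if 0 ≤ t then P t x else Measure.dirac x) := by
    refine Measurable.ite measurableSet_Ici ?_ measurable_const
    refine Measure.measurable_of_measurable_coe _ fun A hA => ?_
    exact (hP.jointMeas A hA).comp (measurable_id.prodMk measurable_const)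
  let κ : ProbabilityTheory.Kernel ℝ X := ⟨_, hm⟩
  have : ProbabilityTheory.IsMarkovKernel κ := ⟨fun t => by
    change IsProbabilityMeasure (if 0 ≤ t then P t x else Measure.dirac x)
    split_ifs with h
    · exact hP.prob t h x
    · infer_instance⟩
  have h1 : StronglyMeasurable (fun t : ℝ => ∫ y, g y ∂(κ t)) :=
    StronglyMeasurable.integral_kernel (f := g) hg.stronglyMeasurable
  refine h1.aestronglyMeasurable.congr ?_
  filter_upwards [ae_restrict_mem measurableSet_Ioi] with t ht
  change ∫ y, g y ∂(if 0 ≤ t then P t x else Measure.dirac x) = _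
  rw [if_pos (le_of_lt ht)]; rfl

/-- The corrector is Lipschitz. -/
lemma corrector_lip {P : ℝ → X → Measure X} (hP : IsMarkovSemigroup P) {γ : ℝ}
    (hA3 : CondA3 P γ) {g : X → ℝ} {K : ℝ≥0} (hLip : LipschitzWith K g) (x y : X) :
    |corrector P g x - corrector P g y| ≤ (K / γ) * dist x y := by
  have hγ := hA3.2.1
  have hg : ∀ a b, |g a - g b| ≤ (K : ℝ) * dist a b := fun a b => by
    have := hLip.dist_le_mul a b
    rwa [Real.dist_eq] at this
  have hexp : IntegrableOn (fun t : ℝ => Real.exp (-γ * t)) (Set.Ioi 0) :=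
    exp_neg_integrableOn_Ioi 0 hγ
  have hexpint : ∫ t in Set.Ioi (0:ℝ), Real.exp (-γ * t) = 1 / γ := by
    rw [integral_exp_mul_Ioi (by linarith)]
    simp
  have hbd : ∀ x y : X, ∀ t ∈ Set.Ioi (0:ℝ), |funAct P t g x - funAct P t g y| ≤
      Real.exp (-γ * t) * (K * dist x y) := fun x y t ht => by
    refine (funAct_lip hP hA3 ht K.2 hg x y).trans (le_of_eq ?_)
    change (K:ℝ) * _ = _
    ring
  have hdiff : ∀ x y : X, IntegrableOn (fun t => funAct P t g x - funAct P t g y)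
      (Set.Ioi 0) := fun x y => by
    refine Integrable.mono' (hexp.mul_const (K * dist x y))
      ((measurable_funAct hP hLip.continuous.measurable x).sub
        (measurable_funAct hP hLip.continuous.measurable y)) ?_
    filter_upwards [ae_restrict_mem measurableSet_Ioi] with t ht
    exact hbd x y t ht
  have hb : |∫ t in Set.Ioi (0:ℝ), (funAct P t g x - funAct P t g y)| ≤ (K / γ) * dist x y := by
    refine abs_integral_le_integral_abs.trans ?_
    refine (integral_mono_ae (hdiff x y).abs (hexp.mul_const (K * dist x y)) ?_).trans ?_
    · filter_upwards [ae_restrict_mem measurableSet_Ioi] with t ht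
      exact hbd x y t ht
    · rw [integral_mul_const, hexpint]
      apply le_of_eq; ring
  by_cases hx : IntegrableOn (fun t => funAct P t g x) (Set.Ioi 0)
  · have hy : IntegrableOn (fun t => funAct P t g y) (Set.Ioi 0) := by
      have := hx.sub (hdiff x y)
      refine this.congr (Eventually.of_forall fun t => ?_)
      simp
    unfold corrector
    rw [← integral_sub hx hy]
    exact hb
  · have hy : ¬ IntegrableOn (fun t => funAct P t g y) (Set.Ioi 0) := fun hy => hx (by
      have := hy.add (hdiff x y)
      refine this.congr (Eventually.of_forall fun t => ?_)
      simp)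
    unfold corrector
    rw [integral_undef hx, integral_undef hy]
    simp only [sub_self, abs_zero]
    positivity

/-! ### The Markov property -/

lemma natFiltration_le {Φ : ℝ → Ω → X} (hΦ : ∀ u, Measurable (Φ u)) (s : ℝ) :
    natFiltration Φ s ≤ (inferInstance : MeasurableSpace Ω) :=
  iSup₂_le fun u _ => (hΦ u).comap_le

lemma measurable_natFiltration {Φ : ℝ → Ω → X} {u s : ℝ} (hu : 0 ≤ u) (hus : u ≤ s) :
    Measurable[natFiltration Φ s] (Φ u) := by
  refine Measurable.of_comap_le ?_
  exact le_iSup₂_of_le (f := fun u (_ : u ∈ Set.Icc (0 : ℝ) s) =>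
    MeasurableSpace.comap (Φ u) inferInstance) u ⟨hu, hus⟩ le_rfl

lemma IsMarkovFamily.meas {P : ℝ → X → Measure X} {Φ : ℝ → Ω → X} {ℙ : X → Measure Ω}
    (hFam : IsMarkovFamily P Φ ℙ) (u : ℝ) : Measurable (Φ u) :=
  hFam.jointMeas.comp (measurable_const.prodMk measurable_id)

/-- Joint form of the Markov property. -/
lemma markov_joint {P : ℝ → X → Measure X} (hP : IsMarkovSemigroup P)
    {Φ : ℝ → Ω → X} {ℙ : X → Measure Ω} (hFam : IsMarkovFamily P Φ ℙ)
    {E : Type*} [MeasurableSpace E] {s h : ℝ} (hs : 0 ≤ s) (hh : 0 ≤ h)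
    {V : Ω → E} (hV : Measurable[natFiltration Φ s] V)
    {F : E × X → ℝ} (hF : Measurable F) {C : ℝ} (hC : ∀ e, |F e| ≤ C) (x : X) :
    ∫ ω, F (V ω, Φ (s + h) ω) ∂(ℙ x) = ∫ ω, ∫ z, F (V ω, z) ∂(P h (Φ s ω)) ∂(ℙ x) := by
  have := hFam.prob x
  have hΦ := hFam.meas
  have hle := natFiltration_le hΦ s
  have hV' : Measurable V := hV.mono hle le_rfl
  let κ : ProbabilityTheory.Kernel Ω X := (kerP hP h).comap (Φ s) (hΦ s)
  have hκ : ∀ ω, κ ω = P h (Φ s ω) := fun ω => rfl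
  have : ProbabilityTheory.IsMarkovKernel κ := ⟨fun ω => by
    rw [hκ]; exact hP.prob h hh _⟩
  have hmap : Measurable (fun q : Ω × X => (V q.1, q.2)) :=
    (hV'.comp measurable_fst).prodMk measurable_snd
  have hpair : Measurable (fun ω => (V ω, Φ (s + h) ω)) := hV'.prodMk (hΦ _)
  have key : (ℙ x).map (fun ω => (V ω, Φ (s + h) ω)) =
      ((ℙ x).compProd κ).map (fun q : Ω × X => (V q.1, q.2)) := by
    have : IsProbabilityMeasure ((ℙ x).map (fun ω => (V ω, Φ (s + h) ω))) :=
      Measure.isProbabilityMeasure_map hpair.aemeasurable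
    refine Measure.ext_prod fun {A B} hA hB => ?_
    rw [Measure.map_apply hpair (hA.prod hB), Measure.map_apply hmap (hA.prod hB)]
    have e1 : (fun q : Ω × X => (V q.1, q.2)) ⁻¹' (A ×ˢ B) = (V ⁻¹' A) ×ˢ B := by
      ext ⟨a, b⟩; simp
    rw [e1, Measure.compProd_apply_prod (hV' hA) hB]
    have hm := hFam.markov x (B.indicator 1) (measurable_one.indicator hB)
      ⟨1, fun z => by
        by_cases hz : z ∈ B <;> simp [hz]⟩ s h hs hh
    have hIntg : Integrable (fun ω => B.indicator (1 : X → ℝ) (Φ (s + h) ω)) (ℙ x) :=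
      integrable_of_bdd ((measurable_one.indicator hB).comp (hΦ _)) (C := 1) fun ω => by
        by_cases hz : Φ (s + h) ω ∈ B <;> simp [hz]
    have h2 := setIntegral_condExp hle hIntg (hV hA)
    have h3 : ∫ ω in V ⁻¹' A, funAct P h (B.indicator 1) (Φ s ω) ∂(ℙ x) =
        ∫ ω in V ⁻¹' A, B.indicator (1 : X → ℝ) (Φ (s + h) ω) ∂(ℙ x) := by
      rw [← h2]
      exact integral_congr_ae (ae_restrict_of_ae hm)
    have h4 : ∀ ω, funAct P h (B.indicator 1) (Φ s ω) = (κ ω B).toReal := fun ω => by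
      unfold funAct
      rw [hκ, integral_indicator_one hB]; rfl
    have h5 : ∫ ω in V ⁻¹' A, B.indicator (1 : X → ℝ) (Φ (s + h) ω) ∂(ℙ x) =
        ((ℙ x) (V ⁻¹' A ∩ Φ (s + h) ⁻¹' B)).toReal := by
      have : (fun ω => B.indicator (1 : X → ℝ) (Φ (s + h) ω)) =
          (Φ (s + h) ⁻¹' B).indicator 1 := by
        ext ω; simp only [Set.indicator]; rfl
      rw [this, integral_indicator_one (hΦ _ hB), Measure.real,
        Measure.restrict_apply (hΦ _ hB), Set.inter_comm]
    simp_rw [h4] at h3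
    rw [h5, integral_toReal] at h3
    · have e2 : (fun ω => (V ω, Φ (s + h) ω)) ⁻¹' (A ×ˢ B) = V ⁻¹' A ∩ Φ (s + h) ⁻¹' B := by
        ext ω; simp
      rw [e2]
      refine ((ENNReal.toReal_eq_toReal_iff' ?_ (measure_ne_top _ _)).1 h3).symm
      refine ne_of_lt (lt_of_le_of_lt (lintegral_mono (g := fun _ => 1) fun ω => prob_le_one) ?_)
      simp
    · exact (ProbabilityTheory.Kernel.measurable_coe κ hB).aemeasurable
    · exact Eventually.of_forall fun ω => measure_lt_top _ _
  have hFm : Measurable (fun q : Ω × X => F (V q.1, q.2)) := hF.comp hmap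
  calc ∫ ω, F (V ω, Φ (s + h) ω) ∂(ℙ x)
      = ∫ e, F e ∂((ℙ x).map (fun ω => (V ω, Φ (s + h) ω))) :=
        (integral_map hpair.aemeasurable hF.aestronglyMeasurable).symm
    _ = ∫ q, F (V q.1, q.2) ∂((ℙ x).compProd κ) := by
        rw [key, integral_map hmap.aemeasurable hF.aestronglyMeasurable]
    _ = _ := by
        rw [Measure.integral_compProd (integrable_of_bdd hFm fun q => hC _)]
        rfl

lemma abs_integral_le_of_bdd {α : Type*} [MeasurableSpace α] {ν : Measure α}
    [IsProbabilityMeasure ν] {f : α → ℝ} {C : ℝ} (hC : ∀ a, |f a| ≤ C) : |∫ a, f a ∂ν| ≤ C := by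
  have := norm_integral_le_of_norm_le_const (μ := ν) (f := f) (C := C)
    (Eventually.of_forall fun z => hC z)
  simpa using this

/-! ### Lipschitz dependence of path functionals on the starting point -/

lemma continuous_of_path_bound {f : (ℕ → X) → ℝ} {J : ℕ} {L : ℕ → ℝ}
    (hf : ∀ a b, |f a - f b| ≤ ∑ j ∈ Finset.range J, L j * dist (a j) (b j)) :
    Continuous f := by
  rw [continuous_iff_continuousAt]
  intro a
  rw [ContinuousAt, tendsto_iff_dist_tendsto_zero]
  have hc : Continuous (fun b : ℕ → X => ∑ j ∈ Finset.range J, L j * dist (b j) (a j)) := by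
    fun_prop
  have h0 : Tendsto (fun b : ℕ → X => ∑ j ∈ Finset.range J, L j * dist (b j) (a j))
      (𝓝 a) (𝓝 0) := by
    have := hc.tendsto a
    simpa using this
  refine squeeze_zero (fun _ => dist_nonneg) (fun b => ?_) h0
  rw [Real.dist_eq]
  exact hf b a

lemma chain_lip {P : ℝ → X → Measure X} (hP : IsMarkovSemigroup P) {γ : ℝ}
    (hA3 : CondA3 P γ) {Φ : ℝ → Ω → X} {ℙ : X → Measure Ω} (hFam : IsMarkovFamily P Φ ℙ)
    {h : ℝ} (hh : 0 < h) (C : ℝ) (J : ℕ) :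
    ∀ (f : (ℕ → X) → ℝ) (L : ℕ → ℝ), (∀ j, 0 ≤ L j) → (∀ a, |f a| ≤ C) →
    (∀ a b, |f a - f b| ≤ ∑ j ∈ Finset.range (J + 1), L j * dist (a j) (b j)) →
    ∀ x y, |(∫ ω, f (fun j => Φ (j * h) ω) ∂(ℙ x)) - ∫ ω, f (fun j => Φ (j * h) ω) ∂(ℙ y)| ≤
      (∑ j ∈ Finset.range (J + 1), L j * Real.exp (-γ * h) ^ j) * dist x y := by
  induction J with
  | zero =>
    intro f L hL hC hf x y
    have hx : ∀ x, ∫ ω, f (fun j => Φ (j * h) ω) ∂(ℙ x) = f (fun _ => x) := by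
      intro x
      have := hFam.prob x
      have hae : ∀ᵐ ω ∂(ℙ x), Φ 0 ω = x := by
        exact (prob_compl_eq_zero_iff
          (measurableSet_eq_fun (hFam.meas 0) measurable_const)).2 (hFam.start x)
      have : ∫ ω, f (fun j => Φ (j * h) ω) ∂(ℙ x) = ∫ ω, f (fun _ => x) ∂(ℙ x) := by
        refine integral_congr_ae ?_
        filter_upwards [hae] with ω hω
        have := hf (fun j => Φ (j * h) ω) (fun _ => x)
        simp only [zero_add, Finset.range_one, Finset.sum_singleton, Nat.cast_zero, zero_mul,
          hω, dist_self, mul_zero, abs_nonpos_iff, sub_eq_zero] at this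
        exact this
      rw [this]; simp
    rw [hx, hx]
    simpa using hf (fun _ => x) (fun _ => y)
  | succ J ih =>
    intro f L hL hC hf x y
    have hcont := continuous_of_path_bound hf
    set q := Real.exp (-γ * h) with hq
    let f' : (ℕ → X) → ℝ := fun a => ∫ z, f (Function.update a (J + 1) z) ∂(P h (a J))
    have hprob : ∀ v, IsProbabilityMeasure (P h v) := fun v => hP.prob h hh.le v
    have hfint : ∀ (a : ℕ → X) v, Integrable (fun z => f (Function.update a (J + 1) z)) (P h v) :=
      fun a v => integrable_of_bdd (hcont.comp (by fun_prop)).measurable fun z => hC _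
    have hstep : ∀ x, ∫ ω, f (fun j => Φ (j * h) ω) ∂(ℙ x) =
        ∫ ω, f' (fun j => Φ (j * h) ω) ∂(ℙ x) := by
      intro x
      let V : Ω → (ℕ → X) := fun ω j => Φ ((min j J : ℕ) * h) ω
      have hV : Measurable[natFiltration Φ (J * h)] V := by
        refine @measurable_pi_lambda _ _ _ (natFiltration Φ (J * h)) _ _ fun j => ?_
        refine measurable_natFiltration (by positivity) ?_
        gcongr
        exact min_le_right _ _
      have hFm : Measurable (fun e : (ℕ → X) × X => f (Function.update e.1 (J + 1) e.2)) :=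
        (hcont.comp (continuous_fst.update (J + 1) continuous_snd)).measurable
      have hm := markov_joint hP hFam (s := J * h) (h := h) (by positivity) hh.le hV hFm
        (fun e => hC _) x
      have hagree : ∀ ω z, f (Function.update (V ω) (J + 1) z) =
          f (Function.update (fun j => Φ (j * h) ω) (J + 1) z) := by
        intro ω z
        have := hf (Function.update (V ω) (J + 1) z)
          (Function.update (fun j => Φ (j * h) ω) (J + 1) z)
        rw [Finset.sum_eq_zero, abs_nonpos_iff, sub_eq_zero] at this
        · exact this
        · intro j hj
          rcases eq_or_ne j (J + 1) with rfl | hne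
          · simp
          · have : j ≤ J := by have := Finset.mem_range.1 hj; omega
            simp only [Function.update_of_ne hne, V, min_eq_left this, dist_self, mul_zero]
      simp only [hagree] at hm
      rw [← hm]
      refine integral_congr_ae (Eventually.of_forall fun ω => ?_)
      simp only
      congr 1
      have e : ((J:ℝ) * h + h) = ((J + 1 : ℕ) : ℝ) * h := by push_cast; ring
      rw [e]
      exact (Function.update_eq_self (J + 1) (fun j : ℕ => Φ (j * h) ω)).symm
    have hC' : ∀ a, |f' a| ≤ C := fun a => abs_integral_le_of_bdd fun z => hC _
    let L' : ℕ → ℝ := fun j => L j + if j = J then q * L (J + 1) else 0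
    have hq0 : 0 ≤ q := (Real.exp_pos _).le
    have hL' : ∀ j, 0 ≤ L' j := fun j => by
      refine add_nonneg (hL j) ?_
      split_ifs
      · exact mul_nonneg hq0 (hL _)
      · exact le_rfl
    have hsum : ∀ w : ℕ → ℝ, ∑ j ∈ Finset.range (J + 1), L' j * w j =
        ∑ j ∈ Finset.range (J + 1), L j * w j + q * L (J + 1) * w J := by
      intro w
      simp only [L', add_mul, Finset.sum_add_distrib, ite_mul, zero_mul]
      rw [Finset.sum_ite_eq' (Finset.range (J + 1)) J]
      simp
    have hf' : ∀ a b, |f' a - f' b| ≤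
        ∑ j ∈ Finset.range (J + 1), L' j * dist (a j) (b j) := by
      intro a b
      rw [hsum (fun j => dist (a j) (b j))]
      have h1 : |∫ z, f (Function.update a (J + 1) z) ∂(P h (a J)) -
          ∫ z, f (Function.update b (J + 1) z) ∂(P h (a J))| ≤
          ∑ j ∈ Finset.range (J + 1), L j * dist (a j) (b j) := by
        rw [← integral_sub (hfint a _) (hfint b _)]
        have := norm_integral_le_of_norm_le_const (μ := P h (a J))
          (f := fun z => f (Function.update a (J + 1) z) - f (Function.update b (J + 1) z))
          (C := ∑ j ∈ Finset.range (J + 1), L j * dist (a j) (b j))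
          (Eventually.of_forall fun z => by
            rw [Real.norm_eq_abs]
            refine (hf _ _).trans (le_of_eq ?_)
            rw [Finset.sum_range_succ]
            simp only [Function.update_self, dist_self, mul_zero, add_zero]
            refine Finset.sum_congr rfl fun j hj => ?_
            have hne : j ≠ J + 1 := by have := Finset.mem_range.1 hj; omega
            rw [Function.update_of_ne hne, Function.update_of_ne hne])
        simpa using this
      have h2 := funAct_lip hP hA3 hh (φ := fun z => f (Function.update b (J + 1) z))
        (hL (J + 1)) (fun u v => by
          refine (hf _ _).trans (le_of_eq ?_)
          rw [Finset.sum_range_succ, Finset.sum_eq_zero]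
          · simp
          · intro j hj
            have hne : j ≠ J + 1 := by have := Finset.mem_range.1 hj; omega
            rw [Function.update_of_ne hne, Function.update_of_ne hne]; simp) (a J) (b J)
      have h3 := abs_sub_le (f' a) (∫ z, f (Function.update b (J + 1) z) ∂(P h (a J))) (f' b)
      refine h3.trans (add_le_add h1 (h2.trans (le_of_eq ?_)))
      rw [← hq]; ring
    have := ih f' L' hL' hC' hf' x y
    rw [hstep, hstep]
    refine this.trans (le_of_eq ?_)
    rw [hsum (fun j => q ^ j), Finset.sum_range_succ _ (J + 1)]
    ring

/-! ### Riemann sums for the additive functional -/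

lemma step_int {N : ℕ} (hN : 1 ≤ N) (M0 : ℕ) (ψ : ℝ → ℝ) :
    ∫ s in ((M0 : ℝ) * (1 / N))..(((M0 + N : ℕ) : ℝ) * (1 / N)), ψ (⌈s * N⌉₊ * (1 / N)) =
      (1 / N) * ∑ r ∈ Finset.range N, ψ ((M0 + r + 1 : ℕ) * (1 / N)) := by
  have hN0 : (0:ℝ) < N := by exact_mod_cast hN
  let t : ℕ → ℝ := fun r => ((M0 + r : ℕ) : ℝ) * (1 / N)
  have hlt : ∀ r, t r ≤ t (r + 1) := fun r => by
    simp only [t]; gcongr; omega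
  have hcell : ∀ r, ∀ s ∈ Set.uIoc (t r) (t (r + 1)),
      ψ (⌈s * N⌉₊ * (1 / N)) = ψ ((M0 + r + 1 : ℕ) * (1 / N)) := by
    intro r s hs
    rw [Set.uIoc_of_le (hlt r)] at hs
    have h1 : ((M0 + r : ℕ) : ℝ) < s * N := by
      have := mul_lt_mul_of_pos_right hs.1 hN0
      simp only [t] at this
      rwa [mul_assoc, one_div_mul_cancel hN0.ne', mul_one] at this
    have h2 : s * N ≤ ((M0 + r + 1 : ℕ) : ℝ) := by
      have := mul_le_mul_of_nonneg_right hs.2 hN0.le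
      simp only [t] at this
      rwa [mul_assoc, one_div_mul_cancel hN0.ne', mul_one] at this
    have : ⌈s * N⌉₊ = M0 + r + 1 := by
      rw [Nat.ceil_eq_iff (by omega)]
      exact ⟨by simpa using h1, h2⟩
    rw [this]
  have hIntg : ∀ r < N, IntervalIntegrable (fun s => ψ (⌈s * N⌉₊ * (1 / N))) volume
      (t r) (t (r + 1)) := fun r _ => by
    refine (intervalIntegrable_const (c := ψ ((M0 + r + 1 : ℕ) * (1 / N)))).congr ?_
    intro s hs
    exact (hcell r s hs).symm
  have h := intervalIntegral.sum_integral_adjacent_intervals hIntg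
  have h0 : t 0 = (M0 : ℝ) * (1 / N) := by simp [t]
  rw [h0] at h
  change _ = ∫ s in ((M0 : ℝ) * (1 / N))..(((M0 + N : ℕ) : ℝ) * (1 / N)), _ at h
  rw [← h, Finset.mul_sum]
  refine Finset.sum_congr rfl fun r _ => ?_
  rw [intervalIntegral.integral_congr_ae (g := fun _ => ψ ((M0 + r + 1 : ℕ) * (1 / N)))
    (Eventually.of_forall fun s hs => hcell r s hs)]
  rw [intervalIntegral.integral_const, smul_eq_mul]
  congr 1
  simp only [t]; push_cast; ring

lemma tendsto_funAct_zero {P : ℝ → X → Measure X} (hP : IsMarkovSemigroup P) (hA1 : CondA1 P)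
    {f : X → ℝ} (hf : Continuous f) {C : ℝ} (hC : ∀ x, |f x| ≤ C) (x : X) :
    Tendsto (fun t => funAct P t f x) (𝓝[≥] (0 : ℝ)) (𝓝 (f x)) := by
  have h1 := hA1 f hf ⟨C, hC⟩ x
  have h0 : funAct P 0 f x = f x := by
    unfold funAct; rw [hP.init]
    exact integral_dirac' _ _ hf.measurable.stronglyMeasurable
  rw [← Set.Ioi_insert, nhdsWithin_insert, tendsto_sup]
  refine ⟨?_, h1⟩
  have := tendsto_pure_nhds (fun t => funAct P t f x) 0
  rwa [h0] at this

/-- Stochastic right-continuity of the process. -/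
lemma stoch_cont {P : ℝ → X → Measure X} (hP : IsMarkovSemigroup P) (hA1 : CondA1 P)
    {Φ : ℝ → Ω → X} {ℙ : X → Measure Ω} (hFam : IsMarkovFamily P Φ ℙ)
    {g : X → ℝ} (hg : Continuous g) {C : ℝ} (hC : ∀ x, |g x| ≤ C) {s : ℝ} (hs : 0 ≤ s)
    {τ : ℕ → ℝ} (hτ : ∀ n, s ≤ τ n) (hlim : Tendsto τ atTop (𝓝 s)) (x : X) :
    Tendsto (fun n => ∫ ω, |g (Φ (τ n) ω) - g (Φ s ω)| ∂(ℙ x)) atTop (𝓝 0) := by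
  have := hFam.prob x
  have hbd : ∀ a b, |(|g a - g b|)| ≤ 2 * C := fun a b => by
    rw [abs_abs]
    refine (abs_sub _ _).trans ?_
    have := hC a
    have := hC b
    linarith
  have hFm : Measurable (fun e : X × X => |g e.2 - g e.1|) := by
    have : Continuous (fun e : X × X => |g e.2 - g e.1|) := by fun_prop
    exact this.measurable
  have e : ∀ n, ∫ ω, |g (Φ (τ n) ω) - g (Φ s ω)| ∂(ℙ x) =
      ∫ ω, ∫ z, |g z - g (Φ s ω)| ∂(P (τ n - s) (Φ s ω)) ∂(ℙ x) := fun n => by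
    have := markov_joint hP hFam (s := s) (h := τ n - s) hs (sub_nonneg.2 (hτ n))
      (measurable_natFiltration (Φ := Φ) hs le_rfl) hFm (fun e => hbd _ _) x
    simpa using this
  simp_rw [e]
  have hτ0 : Tendsto (fun n => τ n - s) atTop (𝓝[≥] 0) := by
    rw [tendsto_nhdsWithin_iff]
    refine ⟨by simpa using hlim.sub_const s, Eventually.of_forall fun n => sub_nonneg.2 (hτ n)⟩
  have hz : ∫ _ω : Ω, (0:ℝ) ∂(ℙ x) = 0 := by simp
  rw [← hz]
  refine tendsto_integral_of_dominated_convergence (fun _ => 2 * C) (fun n => ?_)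
    (integrable_const _) (fun n => Eventually.of_forall fun ω => ?_)
    (Eventually.of_forall fun ω => ?_)
  · let κ := kerP hP (τ n - s)
    have hκ : ProbabilityTheory.IsMarkovKernel κ :=
      ⟨fun v => hP.prob _ (sub_nonneg.2 (hτ n)) v⟩
    have : StronglyMeasurable (fun v => ∫ z, |g z - g v| ∂(κ v)) :=
      StronglyMeasurable.integral_kernel_prod_right' (κ := κ) hFm.stronglyMeasurable
    exact (this.comp_measurable (hFam.meas s)).aestronglyMeasurable
  · have := hP.prob (τ n - s) (sub_nonneg.2 (hτ n)) (Φ s ω)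
    exact abs_integral_le_of_bdd fun z => hbd z (Φ s ω)
  · have hc : Continuous (fun z => |g z - g (Φ s ω)|) := by fun_prop
    have := (tendsto_funAct_zero hP hA1 hc (fun z => hbd z (Φ s ω)) (Φ s ω)).comp hτ0
    simp only [sub_self, abs_zero] at this
    exact this

/-- The smallest point of the grid of mesh `1 / N` to the right of `s`. -/
def gridT (N : ℕ) (s : ℝ) : ℝ := (⌈s * N⌉₊ : ℝ) * (1 / N)

lemma measurable_gridT (N : ℕ) : Measurable (gridT N) := by
  refine Measurable.mul_const ?_ _
  exact (measurable_from_nat (f := fun n : ℕ => (n : ℝ))).comp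
    (Nat.measurable_ceil.comp (measurable_id.mul_const _))

lemma measurable_path {P : ℝ → X → Measure X}
    {Φ : ℝ → Ω → X} {ℙ : X → Measure Ω} (hFam : IsMarkovFamily P Φ ℙ)
    {g : X → ℝ} (hg : Continuous g) (ω : Ω) : Measurable (fun s : ℝ => g (Φ s ω)) := by
  have hp : Measurable (fun s : ℝ => (s, ω)) := measurable_id.prodMk measurable_const
  have h := (hFam.jointMeas).comp hp
  have h2 := hg.measurable.comp h
  exact h2

lemma riem_conv {P : ℝ → X → Measure X} (hP : IsMarkovSemigroup P) (hA1 : CondA1 P)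
    {Φ : ℝ → Ω → X} {ℙ : X → Measure Ω} (hFam : IsMarkovFamily P Φ ℙ)
    {g : X → ℝ} (hg : Continuous g) {C : ℝ} (hC : ∀ x, |g x| ≤ C) {a b : ℝ} (ha : 0 ≤ a)
    (hab : a ≤ b) (x : X) :
    Tendsto (fun N : ℕ => ∫ ω, |(∫ s in a..b, g (Φ (gridT N s) ω)) -
      ∫ s in a..b, g (Φ s ω)| ∂(ℙ x)) atTop (𝓝 0) := by
  have := hFam.prob x
  have hbd : ∀ a b, |(|g a - g b|)| ≤ 2 * C := fun a b => by
    rw [abs_abs]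
    refine (abs_sub _ _).trans ?_
    have := hC a
    have := hC b
    linarith
  have hmΦ := hFam.jointMeas
  have hm1 : Measurable (fun q : ℝ × Ω => g (Φ q.1 q.2)) := hg.measurable.comp hmΦ
  have hm2 : ∀ N : ℕ, Measurable (fun q : ℝ × Ω => g (Φ (gridT N q.1) q.2)) := fun N => by
    have : Measurable (fun q : ℝ × Ω => (gridT N q.1, q.2)) :=
      ((measurable_gridT N).comp measurable_fst).prodMk measurable_snd
    exact hm1.comp this
  let ν : Measure ℝ := volume.restrict (Set.Ioc a b)
  have hνfin : IsFiniteMeasure ν := by infer_instance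
  have hD : ∀ N : ℕ, Measurable (fun q : ℝ × Ω =>
      |g (Φ (gridT N q.1) q.2) - g (Φ q.1 q.2)|) := fun N =>
    ((hm2 N).sub hm1).abs
  have hle : ∀ N : ℕ, ∫ ω, |(∫ s in a..b, g (Φ (gridT N s) ω)) -
      ∫ s in a..b, g (Φ s ω)| ∂(ℙ x) ≤
      ∫ s, ∫ ω, |g (Φ (gridT N s) ω) - g (Φ s ω)| ∂(ℙ x) ∂ν := by
    intro N
    have hsw := integral_integral_swap (μ := ν) (ν := ℙ x)
      (f := fun s ω => |g (Φ (gridT N s) ω) - g (Φ s ω)|)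
      (integrable_of_bdd (hD N) fun q => hbd _ _)
    rw [hsw]
    have hIntg := (integrable_of_bdd (ν := ν.prod (ℙ x)) (hD N) fun q => hbd _ _).integral_prod_right
    refine integral_mono_of_nonneg (Eventually.of_forall fun ω => abs_nonneg _) hIntg
      (Eventually.of_forall fun ω => ?_)
    have h1 := measurable_path hFam hg ω
    simp only
    rw [intervalIntegral.integral_of_le hab, intervalIntegral.integral_of_le hab,
      ← integral_sub]
    · exact abs_integral_le_integral_abs
    · exact integrable_of_bdd (h1.comp (measurable_gridT N)) fun s => hC _
    · exact integrable_of_bdd h1 fun s => hC _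
  refine squeeze_zero (fun N => integral_nonneg fun ω => abs_nonneg _) hle ?_
  have hz : ∫ _s, (0:ℝ) ∂ν = 0 := by simp
  rw [← hz]
  refine tendsto_integral_of_dominated_convergence (fun _ => 2 * C) (fun N => ?_)
    (integrable_const _) (fun N => Eventually.of_forall fun s => ?_) ?_
  · exact ((hD N).stronglyMeasurable.integral_prod_right (ν := ℙ x)).aestronglyMeasurable
  · exact abs_integral_le_of_bdd fun ω => hbd (Φ (gridT N s) ω) (Φ s ω)
  · filter_upwards [ae_restrict_mem measurableSet_Ioc] with s hs
    have hs0 : 0 ≤ s := ha.trans hs.1.le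
    rw [← tendsto_add_atTop_iff_nat 1]
    refine stoch_cont hP hA1 hFam hg hC hs0 (τ := fun N : ℕ => gridT (N + 1) s)
      (fun N => ?_) ?_ x
    · have h0 : (0:ℝ) < (N + 1 : ℕ) := by positivity
      rw [gridT, mul_one_div, le_div_iff₀ h0]
      exact Nat.le_ceil _
    · have h := (tendsto_nat_ceil_mul_div_atTop (R := ℝ) hs0).comp
        ((tendsto_natCast_atTop_atTop (R := ℝ)).comp (tendsto_add_atTop_nat 1))
      refine h.congr fun N => ?_
      simp [gridT, div_eq_mul_inv]

/-! ### Increments on a grid -/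

/-- The increment of the discretized martingale between the times `l` and `l + 1`. -/
def zGrid (P : ℝ → X → Measure X) (g : X → ℝ) (N l : ℕ) (a : ℕ → X) : ℝ :=
  corrector P g (a (l * N + N)) - corrector P g (a (l * N)) +
    (1 / N) * ∑ r ∈ Finset.range N, g (a (l * N + r + 1))

lemma incr_succ {P : ℝ → X → Measure X}
    {Φ : ℝ → Ω → X} {ℙ : X → Measure Ω} (hFam : IsMarkovFamily P Φ ℙ)
    {g : X → ℝ} (hg : Continuous g) {C : ℝ} (hC : ∀ x, |g x| ≤ C) (l : ℕ) (ω : Ω) :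
    incr P g Φ (l + 1) ω = corrector P g (Φ ((l + 1 : ℕ) : ℝ) ω) - corrector P g (Φ (l : ℝ) ω) +
      ∫ s in (l : ℝ)..((l + 1 : ℕ) : ℝ), g (Φ s ω) := by
  have hi : ∀ a b : ℝ, IntervalIntegrable (fun s => g (Φ s ω)) volume a b := fun a b =>
    (intervalIntegrable_const (c := C)).mono_fun'
      (measurable_path hFam hg ω).aestronglyMeasurable (Eventually.of_forall fun s => hC _)
  have h := intervalIntegral.integral_add_adjacent_intervals (hi 0 l) (hi l ((l + 1 : ℕ) : ℝ))
  have e : (((l + 1 : ℕ) : ℝ) - 1) = l := by push_cast; ring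
  unfold incr mart addFun
  rw [e, ← h]
  ring

lemma zGrid_path {P : ℝ → X → Measure X} {Φ : ℝ → Ω → X}
    {g : X → ℝ} {N : ℕ} (hN : 1 ≤ N) (l : ℕ) (ω : Ω) :
    zGrid P g N l (fun j => Φ (j * (1 / N)) ω) =
      corrector P g (Φ ((l + 1 : ℕ) : ℝ) ω) - corrector P g (Φ (l : ℝ) ω) +
      ∫ s in (l : ℝ)..((l + 1 : ℕ) : ℝ), g (Φ (gridT N s) ω) := by
  have hN0 : (N : ℝ) ≠ 0 := by positivity
  have h := step_int hN (l * N) (fun t => g (Φ t ω))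
  have e1 : ((l * N : ℕ) : ℝ) * (1 / N) = l := by push_cast; field_simp
  have e2 : ((l * N + N : ℕ) : ℝ) * (1 / N) = ((l + 1 : ℕ) : ℝ) := by push_cast; field_simp
  rw [e1, e2] at h
  unfold zGrid
  simp only [e1, e2]
  rw [← h]
  rfl

/-- Lipschitz weights of `zGrid`. -/
def wGrid (κ K : ℝ) (N l j : ℕ) : ℝ :=
  κ * ((if j = l * N + N then 1 else 0) + (if j = l * N then 1 else 0)) +
    K * ((1 / N) * ∑ r ∈ Finset.range N, if j = l * N + r + 1 then 1 else 0)

lemma wGrid_nonneg {κ K : ℝ} (hκ : 0 ≤ κ) (hK : 0 ≤ K) (N l j : ℕ) : 0 ≤ wGrid κ K N l j := by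
  unfold wGrid
  have : 0 ≤ ∑ r ∈ Finset.range N, if j = l * N + r + 1 then (1:ℝ) else 0 :=
    Finset.sum_nonneg fun r _ => by split_ifs <;> norm_num
  have h1 : (0:ℝ) ≤ (if j = l * N + N then 1 else 0) := by split_ifs <;> norm_num
  have h2 : (0:ℝ) ≤ (if j = l * N then 1 else 0) := by split_ifs <;> norm_num
  positivity

lemma sum_wGrid (κ K : ℝ) (N l J : ℕ) (hJ : l * N + N ≤ J) (φ : ℕ → ℝ) :
    ∑ j ∈ Finset.range (J + 1), wGrid κ K N l j * φ j =
      κ * (φ (l * N + N) + φ (l * N)) +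
        K * ((1 / N) * ∑ r ∈ Finset.range N, φ (l * N + r + 1)) := by
  have hpt : ∀ i ≤ J, ∑ j ∈ Finset.range (J + 1), (if j = i then (1:ℝ) else 0) * φ j = φ i := by
    intro i hi
    simp only [ite_mul, one_mul, zero_mul]
    rw [Finset.sum_ite_eq']
    simp [Nat.lt_succ_of_le hi]
  unfold wGrid
  simp only [add_mul, mul_assoc, Finset.sum_add_distrib, ← Finset.mul_sum]
  rw [hpt _ hJ, hpt _ (by omega)]
  congr 3
  simp only [Finset.sum_mul]
  rw [Finset.sum_comm]
  refine Finset.sum_congr rfl fun r hr => ?_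
  have := Finset.mem_range.1 hr
  exact hpt _ (by omega)

lemma zGrid_lip {P : ℝ → X → Measure X} (hP : IsMarkovSemigroup P) {γ : ℝ}
    (hA3 : CondA3 P γ) {g : X → ℝ} {K : ℝ≥0} (hLip : LipschitzWith K g) (N l J : ℕ)
    (hJ : l * N + N ≤ J) (a b : ℕ → X) :
    |zGrid P g N l a - zGrid P g N l b| ≤
      ∑ j ∈ Finset.range (J + 1), wGrid (K / γ) K N l j * dist (a j) (b j) := by
  rw [sum_wGrid _ _ _ _ _ hJ (fun j => dist (a j) (b j))]
  have h1 := corrector_lip hP hA3 hLip (a (l * N + N)) (b (l * N + N))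
  have h2 := corrector_lip hP hA3 hLip (a (l * N)) (b (l * N))
  have h3 : |(1 / (N:ℝ)) * ∑ r ∈ Finset.range N, g (a (l * N + r + 1)) -
      (1 / (N:ℝ)) * ∑ r ∈ Finset.range N, g (b (l * N + r + 1))| ≤
      K * ((1 / N) * ∑ r ∈ Finset.range N, dist (a (l * N + r + 1)) (b (l * N + r + 1))) := by
    rw [← mul_sub, ← Finset.sum_sub_distrib, abs_mul, abs_of_nonneg (by positivity), mul_left_comm,
      Finset.mul_sum (a := (K : ℝ))]
    gcongr
    refine (Finset.abs_sum_le_sum_abs _ _).trans (Finset.sum_le_sum fun r _ => ?_)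
    have := hLip.dist_le_mul (a (l * N + r + 1)) (b (l * N + r + 1))
    rwa [Real.dist_eq] at this
  unfold zGrid
  rw [abs_le] at *
  constructor <;> linarith [h1.1, h1.2, h2.1, h2.2, h3.1, h3.2]

lemma sum_wGrid_pow_le {κ K q : ℝ} (hκ : 0 ≤ κ) (hK : 0 ≤ K) (hq : 0 ≤ q) (hq1 : q ≤ 1)
    {N : ℕ} (hN : 1 ≤ N) (l J : ℕ) (hJ : l * N + N ≤ J) :
    ∑ j ∈ Finset.range (J + 1), wGrid κ K N l j * q ^ j ≤ (2 * κ + K) * (q ^ N) ^ l := by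
  rw [sum_wGrid _ _ _ _ _ hJ (fun j => q ^ j), ← pow_mul, mul_comm N l]
  have hle : ∀ i, l * N ≤ i → q ^ i ≤ q ^ (l * N) := fun i hi =>
    pow_le_pow_of_le_one hq hq1 hi
  have hN0 : (N : ℝ) ≠ 0 := by positivity
  have h3 : (1 / (N:ℝ)) * ∑ r ∈ Finset.range N, q ^ (l * N + r + 1) ≤ q ^ (l * N) := by
    calc _ ≤ (1 / (N:ℝ)) * ∑ r ∈ Finset.range N, q ^ (l * N) := by
          exact mul_le_mul_of_nonneg_left
            (Finset.sum_le_sum fun r _ => hle _ (by omega)) (by positivity)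
      _ = _ := by
          rw [Finset.sum_const, Finset.card_range, nsmul_eq_mul]; field_simp
  have h1 := hle (l * N + N) (by omega)
  have := mul_le_mul_of_nonneg_left h3 hK
  have := mul_le_mul_of_nonneg_left h1 hκ
  nlinarith

/-! ### The uniform bound for finite windows -/

lemma truncMin_cont (p : ℕ∞) : Continuous (fun a : ℝ => truncMin a p) := by
  unfold truncMin
  split_ifs <;> fun_prop

lemma avg_cont (p : ℕ∞) (j : ℕ) : Continuous (avg p j) := by
  unfold avg
  refine continuous_const.mul (continuous_finset_sum _ fun k _ => ?_)
  exact (truncMin_cont p).comp (by fun_prop)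

lemma win_cont (c : ℝ) (p : ℕ∞) (n m : ℕ) : Continuous (win c p n m) := by
  unfold win
  refine Continuous.finset_inf'_apply _ fun j _ => ?_
  exact continuous_const.mul (cpt_cont.comp (avg_cont p _))

lemma grid_bound {P : ℝ → X → Measure X} (hP : IsMarkovSemigroup P) {γ : ℝ}
    (hA3 : CondA3 P γ) {g : X → ℝ} {K : ℝ≥0} (hLip : LipschitzWith K g)
    {Φ : ℝ → Ω → X} {ℙ : X → Measure Ω} (hFam : IsMarkovFamily P Φ ℙ)
    {H : ℝ → ℝ} {LH CH : ℝ} (hLH : 0 ≤ LH) (hH : ∀ u v, |H u - H v| ≤ LH * |u - v|)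
    (hCH : ∀ u, |H u| ≤ CH) (c : ℝ) (p : ℕ∞) (i : ℕ) {n : ℕ} (hn : 1 ≤ n) (m : ℕ) {N : ℕ}
    (hN : 1 ≤ N) (x y : X) :
    |(∫ ω, H (win c p n m (fun k => zGrid P g N (2 * k + i - 1) (fun j => Φ (j * (1 / N)) ω)))
        ∂(ℙ x)) -
      ∫ ω, H (win c p n m (fun k => zGrid P g N (2 * k + i - 1) (fun j => Φ (j * (1 / N)) ω)))
        ∂(ℙ y)| ≤
    (LH * (|c| * (1 / √(n : ℝ)))) * ((2 * (K / γ) + K) * (1 - Real.exp (-γ))⁻¹) * dist x y ∧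
    Measurable (fun ω =>
      H (win c p n m (fun k => zGrid P g N (2 * k + i - 1) (fun j => Φ (j * (1 / N)) ω)))) := by
  have hγ := hA3.2.1
  have hN0 : (0:ℝ) < N := by exact_mod_cast hN
  set B := LH * (|c| * (1 / √(n : ℝ))) with hB
  have hB0 : 0 ≤ B := by positivity
  have hκ0 : 0 ≤ (K : ℝ) / γ := by positivity
  set J := (2 * (n + m) + i) * N with hJ
  let f : (ℕ → X) → ℝ := fun a => H (win c p n m (fun k => zGrid P g N (2 * k + i - 1) a))
  let L : ℕ → ℝ := fun j => B * ∑ k ∈ Finset.Icc 1 (n + m), wGrid (K / γ) K N (2 * k + i - 1) j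
  have hL : ∀ j, 0 ≤ L j := fun j =>
    mul_nonneg hB0 (Finset.sum_nonneg fun k _ => wGrid_nonneg hκ0 K.2 _ _ _)
  have hJk : ∀ k ∈ Finset.Icc 1 (n + m), (2 * k + i - 1) * N + N ≤ J := by
    intro k hk
    rw [Finset.mem_Icc] at hk
    have : (2 * k + i - 1) * N + N = (2 * k + i) * N := by
      have : 2 * k + i = (2 * k + i - 1) + 1 := by omega
      conv_rhs => rw [this]
      ring
    rw [this, hJ]
    gcongr
    exact hk.2
  have hsum : ∀ φ : ℕ → ℝ, ∑ j ∈ Finset.range (J + 1), L j * φ j =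
      B * ∑ k ∈ Finset.Icc 1 (n + m), ∑ j ∈ Finset.range (J + 1),
        wGrid (K / γ) K N (2 * k + i - 1) j * φ j := by
    intro φ
    rw [Finset.sum_comm, Finset.mul_sum]
    refine Finset.sum_congr rfl fun j _ => ?_
    simp only [L]
    rw [mul_assoc, Finset.sum_mul]
  have hf : ∀ a b, |f a - f b| ≤ ∑ j ∈ Finset.range (J + 1), L j * dist (a j) (b j) := by
    intro a b
    rw [hsum (fun j => dist (a j) (b j))]
    refine (hH _ _).trans ?_
    rw [hB, mul_assoc]
    gcongr
    refine (win_lip c p m hn _ _).trans ?_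
    rw [← mul_assoc]
    gcongr with k hk
    exact zGrid_lip hP hA3 hLip _ _ _ (hJk k hk) a b
  have hq0 : 0 ≤ Real.exp (-γ * (1 / N)) := (Real.exp_pos _).le
  have hq1 : Real.exp (-γ * (1 / N)) ≤ 1 := by
    rw [Real.exp_le_one_iff]
    have : 0 < γ * (1 / N) := by positivity
    linarith
  have hqN : Real.exp (-γ * (1 / N)) ^ N = Real.exp (-γ) := by
    rw [← Real.exp_nat_mul]
    congr 1
    field_simp
  have hρ0 : 0 ≤ Real.exp (-γ) := (Real.exp_pos _).le
  have hρ1 : Real.exp (-γ) < 1 := by rw [Real.exp_lt_one_iff]; linarith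
  refine ⟨?_, ?_⟩
  · have h := chain_lip hP hA3 hFam (h := 1 / (N:ℝ)) (by positivity) CH J f L hL
      (fun a => hCH _) hf x y
    refine h.trans ?_
    rw [hsum (fun j => Real.exp (-γ * (1 / N)) ^ j)]
    gcongr
    calc _ ≤ ∑ k ∈ Finset.Icc 1 (n + m), (2 * (K / γ) + K) * Real.exp (-γ) ^ k := by
          refine Finset.sum_le_sum fun k hk => ?_
          refine (sum_wGrid_pow_le hκ0 K.2 hq0 hq1 hN _ _ (hJk k hk)).trans ?_
          rw [hqN]
          change (2 * (K / γ) + (K : ℝ)) * _ ≤ _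
          have : k ≤ 2 * k + i - 1 := by
            rw [Finset.mem_Icc] at hk; omega
          exact mul_le_mul_of_nonneg_left (pow_le_pow_of_le_one hρ0 hρ1.le this) (by positivity)
      _ ≤ _ := by
          rw [← Finset.mul_sum]
          gcongr
          rw [← tsum_geometric_of_lt_one hρ0 hρ1]
          exact (summable_geometric_of_lt_one hρ0 hρ1).sum_le_tsum _ fun _ _ => by positivity
  · have hc := (continuous_of_path_bound hf).measurable
    have hpath : Measurable (fun ω => (fun j : ℕ => Φ (j * (1 / N)) ω)) :=
      measurable_pi_lambda _ fun j => hFam.meas _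
    exact hc.comp hpath

lemma measurable_incr {P : ℝ → X → Measure X} (hP : IsMarkovSemigroup P) {γ : ℝ}
    (hA3 : CondA3 P γ) {g : X → ℝ} {K : ℝ≥0} (hLip : LipschitzWith K g)
    {C : ℝ} (hC : ∀ x, |g x| ≤ C)
    {Φ : ℝ → Ω → X} {ℙ : X → Measure Ω} (hFam : IsMarkovFamily P Φ ℙ) (l : ℕ) :
    Measurable (fun ω => incr P g Φ (l + 1) ω) := by
  have hcor : Continuous (corrector P g) :=
    (LipschitzWith.of_dist_le_mul (K := Real.toNNReal (K / γ)) fun a b => by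
      have := hA3.2.1
      rw [Real.dist_eq, Real.coe_toNNReal _ (by positivity)]
      exact corrector_lip hP hA3 hLip a b).continuous
  simp_rw [incr_succ hFam hLip.continuous hC]
  refine ((hcor.measurable.comp (hFam.meas _)).sub (hcor.measurable.comp (hFam.meas _))).add ?_
  simp_rw [intervalIntegral.integral_of_le (show (l:ℝ) ≤ ((l + 1 : ℕ) : ℝ) by simp)]
  have hm1 : Measurable (fun q : ℝ × Ω => g (Φ q.1 q.2)) :=
    hLip.continuous.measurable.comp hFam.jointMeas
  exact (hm1.stronglyMeasurable.integral_prod_left' (μ := volume.restrict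
    (Set.Ioc (l:ℝ) ((l + 1 : ℕ) : ℝ)))).measurable

lemma measurable_incrSeq {P : ℝ → X → Measure X} (hP : IsMarkovSemigroup P) {γ : ℝ}
    (hA3 : CondA3 P γ) {g : X → ℝ} {K : ℝ≥0} (hLip : LipschitzWith K g)
    {C : ℝ} (hC : ∀ x, |g x| ≤ C)
    {Φ : ℝ → Ω → X} {ℙ : X → Measure Ω} (hFam : IsMarkovFamily P Φ ℙ) (i : ℕ) :
    Measurable (fun ω => (fun k : ℕ => incr P g Φ ((2 * k + i - 1) + 1) ω)) :=
  measurable_pi_lambda _ fun k => measurable_incr hP hA3 hLip hC hFam _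

lemma win_bound {P : ℝ → X → Measure X} (hP : IsMarkovSemigroup P) {γ : ℝ} (hA1 : CondA1 P)
    (hA3 : CondA3 P γ) {g : X → ℝ} {K : ℝ≥0} (hLip : LipschitzWith K g)
    {C : ℝ} (hC : ∀ x, |g x| ≤ C)
    {Φ : ℝ → Ω → X} {ℙ : X → Measure Ω} (hFam : IsMarkovFamily P Φ ℙ)
    {H : ℝ → ℝ} {LH CH : ℝ} (hLH : 0 ≤ LH) (hH : ∀ u v, |H u - H v| ≤ LH * |u - v|)
    (hHc : Continuous H)
    (hCH : ∀ u, |H u| ≤ CH) (c : ℝ) (p : ℕ∞) (i : ℕ) {n : ℕ} (hn : 1 ≤ n) (m : ℕ) (x y : X) :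
    |(∫ ω, H (win c p n m (fun k => incr P g Φ ((2 * k + i - 1) + 1) ω)) ∂(ℙ x)) -
      ∫ ω, H (win c p n m (fun k => incr P g Φ ((2 * k + i - 1) + 1) ω)) ∂(ℙ y)| ≤
    (LH * (|c| * (1 / √(n : ℝ)))) * ((2 * (K / γ) + K) * (1 - Real.exp (-γ))⁻¹) * dist x y := by
  have hg := hLip.continuous
  have hmZ : Measurable (fun ω => H (win c p n m (fun k => incr P g Φ ((2 * k + i - 1) + 1) ω))) :=
    (hHc.comp (win_cont c p n m)).measurable.comp (measurable_incrSeq hP hA3 hLip hC hFam i)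
  have hconv : ∀ x, Tendsto (fun N : ℕ => ∫ ω, H (win c p n m (fun k =>
      zGrid P g N (2 * k + i - 1) (fun j => Φ (j * (1 / N)) ω))) ∂(ℙ x)) atTop
      (𝓝 (∫ ω, H (win c p n m (fun k => incr P g Φ ((2 * k + i - 1) + 1) ω)) ∂(ℙ x))) := by
    intro x
    have := hFam.prob x
    let R : ℕ → ℕ → Ω → ℝ := fun N l ω =>
      |(∫ s in (l:ℝ)..((l + 1 : ℕ) : ℝ), g (Φ (gridT N s) ω)) -
        ∫ s in (l:ℝ)..((l + 1 : ℕ) : ℝ), g (Φ s ω)|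
    have hR : ∀ l, Tendsto (fun N => ∫ ω, R N l ω ∂(ℙ x)) atTop (𝓝 0) := fun l =>
      riem_conv hP hA1 hFam hg hC (Nat.cast_nonneg l) (by simp) x
    have hRm : ∀ N l, Measurable (R N l) := by
      intro N l
      have hm1 : Measurable (fun q : ℝ × Ω => g (Φ q.1 q.2)) := hg.measurable.comp hFam.jointMeas
      have hp : Measurable (fun q : ℝ × Ω => (gridT N q.1, q.2)) :=
        ((measurable_gridT N).comp measurable_fst).prodMk measurable_snd
      have hm2 : Measurable (fun q : ℝ × Ω => g (Φ (gridT N q.1) q.2)) := hm1.comp hp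
      simp only [R]
      simp_rw [intervalIntegral.integral_of_le (show (l:ℝ) ≤ ((l + 1 : ℕ) : ℝ) by simp)]
      have e1 := (hm1.stronglyMeasurable.integral_prod_left' (μ := volume.restrict
        (Set.Ioc (l:ℝ) ((l + 1 : ℕ) : ℝ)))).measurable
      have e2 := (hm2.stronglyMeasurable.integral_prod_left' (μ := volume.restrict
        (Set.Ioc (l:ℝ) ((l + 1 : ℕ) : ℝ)))).measurable
      exact (e2.sub e1).abs
    have hI : ∀ ψ : ℝ → ℝ, (∀ s, |ψ s| ≤ C) → ∀ l : ℕ,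
        |∫ s in (l:ℝ)..((l + 1 : ℕ) : ℝ), ψ s| ≤ C := by
      intro ψ hψ l
      have := intervalIntegral.norm_integral_le_of_norm_le_const (f := ψ) (C := C)
        (a := (l:ℝ)) (b := ((l + 1 : ℕ) : ℝ)) fun s _ => hψ s
      simpa using this
    have hRb : ∀ N l ω, |R N l ω| ≤ 2 * C := by
      intro N l ω
      simp only [R, abs_abs]
      refine (abs_sub _ _).trans ?_
      have h1 := hI (fun s => g (Φ (gridT N s) ω)) (fun s => hC _) l
      have h2 := hI (fun s => g (Φ s ω)) (fun s => hC _) l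
      linarith
    have hRi : ∀ N l, Integrable (R N l) (ℙ x) := fun N l => integrable_of_bdd (hRm N l) (hRb N l)
    have hlim : Tendsto (fun N => LH * (|c| * ((1 / √(n : ℝ)) *
        ∑ k ∈ Finset.Icc 1 (n + m), ∫ ω, R N (2 * k + i - 1) ω ∂(ℙ x)))) atTop (𝓝 0) := by
      have h1 : Tendsto (fun N => ∑ k ∈ Finset.Icc 1 (n + m), ∫ ω, R N (2 * k + i - 1) ω ∂(ℙ x))
          atTop (𝓝 (∑ k ∈ Finset.Icc 1 (n + m), 0)) :=
        tendsto_finset_sum _ fun k _ => hR _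
      have h2 := ((h1.const_mul (1 / √(n : ℝ))).const_mul |c|).const_mul LH
      simpa using h2
    rw [tendsto_iff_dist_tendsto_zero]
    refine squeeze_zero' (Eventually.of_forall fun _ => dist_nonneg) ?_ hlim
    filter_upwards [eventually_ge_atTop 1] with N hN
    have hmG := (grid_bound hP hA3 hLip hFam hLH hH hCH c p i hn m hN x x).2
    rw [Real.dist_eq, ← integral_sub (integrable_of_bdd hmG fun ω => hCH _)
      (integrable_of_bdd hmZ fun ω => hCH _)]
    refine abs_integral_le_integral_abs.trans ?_
    rw [← integral_finset_sum _ (fun k _ => hRi N _), ← integral_const_mul, ← integral_const_mul,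
      ← integral_const_mul]
    refine integral_mono_of_nonneg (Eventually.of_forall fun ω => abs_nonneg _) ?_
      (Eventually.of_forall fun ω => ?_)
    · exact (((integrable_finset_sum _ fun k _ => hRi N _).const_mul _).const_mul _).const_mul _
    · simp only
      refine (hH _ _).trans ?_
      gcongr
      refine (win_lip c p m hn _ _).trans (le_of_eq ?_)
      congr 2
      refine Finset.sum_congr rfl fun k _ => ?_
      rw [zGrid_path hN, incr_succ hFam hg hC]
      simp only [R, add_sub_add_left_eq_sub]
  refine le_of_tendsto ((hconv x).sub (hconv y)).abs ?_
  filter_upwards [eventually_ge_atTop 1] with N hN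
  exact (grid_bound hP hA3 hLip hFam hLH hH hCH c p i hn m hN x y).1

/-! ### The law of the limit does not depend on the starting point -/

lemma abs_mul_cpt_le (c a : ℝ) : |c * cpt a| ≤ |c| := by
  rw [abs_mul, abs_of_nonneg (cpt_nonneg a)]
  exact mul_le_of_le_one_right (abs_nonneg _) (cpt_lt_one a).le

lemma integral_H_eq {P : ℝ → X → Measure X} (hP : IsMarkovSemigroup P) {γ : ℝ} (hA1 : CondA1 P)
    (hA3 : CondA3 P γ) {g : X → ℝ} {K : ℝ≥0} (hLip : LipschitzWith K g)
    {C : ℝ} (hC : ∀ x, |g x| ≤ C)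
    {Φ : ℝ → Ω → X} {ℙ : X → Measure Ω} (hFam : IsMarkovFamily P Φ ℙ)
    {H : ℝ → ℝ} {LH CH : ℝ} (hLH : 0 ≤ LH) (hH : ∀ u v, |H u - H v| ≤ LH * |u - v|)
    (hHc : Continuous H)
    (hCH : ∀ u, |H u| ≤ CH) (c : ℝ) (p : ℕ∞) (i : ℕ) (x y : X) :
    ∫ ω, H (liminf (fun n => c * cpt (avg p n
        (fun k => incr P g Φ ((2 * k + i - 1) + 1) ω))) atTop) ∂(ℙ x) =
    ∫ ω, H (liminf (fun n => c * cpt (avg p n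
        (fun k => incr P g Φ ((2 * k + i - 1) + 1) ω))) atTop) ∂(ℙ y) := by
  let v : ℕ → Ω → ℝ := fun n ω => c * cpt (avg p n
        (fun k => incr P g Φ ((2 * k + i - 1) + 1) ω))
  have hv : ∀ n ω, |v n ω| ≤ |c| := fun n ω => abs_mul_cpt_le _ _
  have hmW : ∀ n m, Measurable (fun ω =>
      H (win c p n m (fun k => incr P g Φ ((2 * k + i - 1) + 1) ω))) := fun n m =>
    (hHc.comp (win_cont c p n m)).measurable.comp (measurable_incrSeq hP hA3 hLip hC hFam i)
  have hvm : ∀ n, Measurable (v n) := fun n =>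
    (continuous_const.mul (cpt_cont.comp (avg_cont p n))).measurable.comp
      (measurable_incrSeq hP hA3 hLip hC hFam i)
  have hmI : ∀ n, Measurable (fun ω => H (⨅ j, v (n + j) ω)) := fun n =>
    hHc.measurable.comp (Measurable.iInf fun j => hvm (n + j))
  have hconv1 : ∀ x n, Tendsto (fun m => ∫ ω, H (win c p n m
      (fun k => incr P g Φ ((2 * k + i - 1) + 1) ω)) ∂(ℙ x)) atTop
      (𝓝 (∫ ω, H (⨅ j, v (n + j) ω) ∂(ℙ x))) := by
    intro x n
    have := hFam.prob x
    refine tendsto_integral_of_dominated_convergence (fun _ => CH)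
      (fun m => (hmW n m).aestronglyMeasurable)
      (integrable_const _) (fun m => Eventually.of_forall fun ω => hCH _)
      (Eventually.of_forall fun ω => ?_)
    exact (hHc.tendsto _).comp (tendsto_inf'_range (fun j => v (n + j) ω) (-|c|)
      fun j => (abs_le.1 (hv _ _)).1)
  have hconv2 : ∀ x, Tendsto (fun n => ∫ ω, H (⨅ j, v (n + j) ω) ∂(ℙ x)) atTop
      (𝓝 (∫ ω, H (liminf (fun n => v n ω) atTop) ∂(ℙ x))) := by
    intro x
    have := hFam.prob x
    refine tendsto_integral_of_dominated_convergence (fun _ => CH)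
      (fun n => (hmI n).aestronglyMeasurable)
      (integrable_const _) (fun m => Eventually.of_forall fun ω => hCH _)
      (Eventually.of_forall fun ω => ?_)
    exact (hHc.tendsto _).comp (tendsto_iInf_shift (fun j => v j ω) |c| fun j => hv _ _)
  have hb : ∀ n, 1 ≤ n → |(∫ ω, H (⨅ j, v (n + j) ω) ∂(ℙ x)) - ∫ ω, H (⨅ j, v (n + j) ω) ∂(ℙ y)| ≤
      (LH * (|c| * (1 / √(n : ℝ)))) * ((2 * (K / γ) + K) * (1 - Real.exp (-γ))⁻¹) * dist x y := by
    intro n hn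
    refine le_of_tendsto ((hconv1 x n).sub (hconv1 y n)).abs (Eventually.of_forall fun m => ?_)
    exact win_bound hP hA1 hA3 hLip hC hFam hLH hH hHc hCH c p i hn m x y
  have hlim : Tendsto (fun n : ℕ => (LH * (|c| * (1 / √(n : ℝ)))) *
      ((2 * (K / γ) + K) * (1 - Real.exp (-γ))⁻¹) * dist x y) atTop (𝓝 0) := by
    have h0 : Tendsto (fun n : ℕ => 1 / √(n : ℝ)) atTop (𝓝 0) := by
      simp_rw [one_div]
      exact (Real.tendsto_sqrt_atTop.comp tendsto_natCast_atTop_atTop).inv_tendsto_atTop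
    have := (((h0.const_mul |c|).const_mul LH).mul_const
      ((2 * (K / γ) + K) * (1 - Real.exp (-γ))⁻¹)).mul_const (dist x y)
    simpa using this
  have h := le_of_tendsto_of_tendsto ((hconv2 x).sub (hconv2 y)).abs hlim
    ((eventually_ge_atTop 1).mono hb)
  exact sub_eq_zero.1 (abs_nonpos_iff.1 h)

lemma law_eq {P : ℝ → X → Measure X} (hP : IsMarkovSemigroup P) {γ : ℝ} (hA1 : CondA1 P)
    (hA3 : CondA3 P γ) {g : X → ℝ} {K : ℝ≥0} (hLip : LipschitzWith K g)
    {C : ℝ} (hC : ∀ x, |g x| ≤ C)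
    {Φ : ℝ → Ω → X} {ℙ : X → Measure Ω} (hFam : IsMarkovFamily P Φ ℙ)
    (c : ℝ) (p : ℕ∞) (i : ℕ) {G : ℝ → ℝ} (hG : Measurable G) (x y : X) :
    ∫ ω, G (liminf (fun n => c * cpt (avg p n
        (fun k => incr P g Φ ((2 * k + i - 1) + 1) ω))) atTop) ∂(ℙ x) =
    ∫ ω, G (liminf (fun n => c * cpt (avg p n
        (fun k => incr P g Φ ((2 * k + i - 1) + 1) ω))) atTop) ∂(ℙ y) := by
  set U : Ω → ℝ := fun ω => liminf (fun n => c * cpt (avg p n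
        (fun k => incr P g Φ ((2 * k + i - 1) + 1) ω))) atTop with hU
  have hvm : ∀ n, Measurable (fun ω => c * cpt (avg p n
        (fun k => incr P g Φ ((2 * k + i - 1) + 1) ω))) := fun n =>
    (continuous_const.mul (cpt_cont.comp (avg_cont p n))).measurable.comp
      (measurable_incrSeq hP hA3 hLip hC hFam i)
  have hUm : Measurable U := Measurable.liminf hvm
  have hpr := hFam.prob
  have key : (ℙ x).map U = (ℙ y).map U := by
    have : ∀ x, IsProbabilityMeasure ((ℙ x).map U) := fun x =>
      Measure.isProbabilityMeasure_map hUm.aemeasurable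
    refine Measure.ext_of_charFun (funext fun t => ?_)
    have hcos : ∀ u v : ℝ, |Real.cos (t * u) - Real.cos (t * v)| ≤ |t| * |u - v| := fun u v => by
      have := Real.abs_cos_sub_cos_le (t * u) (t * v)
      rwa [← mul_sub, abs_mul] at this
    have hsin : ∀ u v : ℝ, |Real.sin (t * u) - Real.sin (t * v)| ≤ |t| * |u - v| := fun u v => by
      have := Real.abs_sin_sub_sin_le (t * u) (t * v)
      rwa [← mul_sub, abs_mul] at this
    have e1 := integral_H_eq hP hA1 hA3 hLip hC hFam (abs_nonneg t) hcos (by fun_prop)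
      (fun u => Real.abs_cos_le_one _) c p i x y
    have e2 := integral_H_eq hP hA1 hA3 hLip hC hFam (abs_nonneg t) hsin (by fun_prop)
      (fun u => Real.abs_sin_le_one _) c p i x y
    have hch : ∀ x, charFun ((ℙ x).map U) t =
        ((∫ ω, Real.cos (t * U ω) ∂(ℙ x) : ℝ) : ℂ) +
          ((∫ ω, Real.sin (t * U ω) ∂(ℙ x) : ℝ) : ℂ) * Complex.I := by
      intro x
      rw [charFun_apply_real, integral_map hUm.aemeasurable (by fun_prop)]
      have hc : Integrable (fun ω => Real.cos (t * U ω)) (ℙ x) :=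
        integrable_of_bdd (by fun_prop) fun ω => Real.abs_cos_le_one _
      have hs : Integrable (fun ω => Real.sin (t * U ω)) (ℙ x) :=
        integrable_of_bdd (by fun_prop) fun ω => Real.abs_sin_le_one _
      rw [← integral_complex_ofReal, ← integral_complex_ofReal, ← integral_mul_const,
        ← integral_add hc.ofReal (hs.ofReal.mul_const _)]
      refine integral_congr_ae (Eventually.of_forall fun ω => ?_)
      simp only
      rw [Complex.exp_mul_I]
      push_cast
      rfl
    rw [hch, hch, e1, e2]
  rw [← integral_map hUm.aemeasurable hG.aestronglyMeasurable, key,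
    integral_map hUm.aemeasurable hG.aestronglyMeasurable]

/-- Lemma 5. Under (A1)–(A4), for `p ∈ ℕ ∪ {∞}`, `d ≥ 0`, `i ∈ {0,1}`,
the functions `x ↦ E_x[|liminf_n (1/n)Σ_{k=1}^n (Z_{2k+i}(g)² ∧ p) - d| ∧ 1]` and its
`limsup` analogue are continuous on `X`. -/
theorem liminf_limsup_expectations_continuous
    (P : ℝ → X → Measure X) (hP : IsMarkovSemigroup P)
    (γ ζ : ℝ) (x₀ : X) (μ μstar : Measure X)
    [IsProbabilityMeasure μ] [IsProbabilityMeasure μstar]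
    (hA1 : CondA1 P) (hA2 : CondA2 P) (hA3 : CondA3 P γ) (hA4 : CondA4 P μ x₀ ζ)
    (hinv : ∀ t, 0 ≤ t → measAct P t μstar = μstar)
    (g : X → ℝ) (K : ℝ≥0) (hLip : LipschitzWith K g) (hBd : ∃ C, ∀ x, |g x| ≤ C)
    (hmean : ∫ x, g x ∂μstar = 0)
    (ℙ : X → Measure Ω) (Φ : ℝ → Ω → X) (hFam : IsMarkovFamily P Φ ℙ) :
    ∀ p : ℕ∞, ∀ d : ℝ, 0 ≤ d → ∀ i : ℕ, i ≤ 1 →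
      Continuous (fun x : X => ∫ ω,
        min |Filter.liminf (fun n : ℕ =>
            (1 / (n : ℝ)) *
              ∑ k ∈ Finset.Icc 1 n, truncMin ((incr P g Φ (2 * k + i) ω) ^ 2) p)
          Filter.atTop - d| 1 ∂(ℙ x)) ∧
      Continuous (fun x : X => ∫ ω,
        min |Filter.limsup (fun n : ℕ =>
            (1 / (n : ℝ)) *
              ∑ k ∈ Finset.Icc 1 n, truncMin ((incr P g Φ (2 * k + i) ω) ^ 2) p)
          Filter.atTop - d| 1 ∂(ℙ x)) := by
  obtain ⟨C, hC⟩ := hBd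
  intro p d hd i hi
  have hGm : Measurable (fun u : ℝ => min |unc u - d| 1) := by
    unfold unc; fun_prop
  have hGm' : Measurable (fun u : ℝ => min |unc (-u) - d| 1) := by
    unfold unc; fun_prop
  -- the averages, rewritten with the index shifted by one
  have havg : ∀ ω (n : ℕ), (1 / (n : ℝ)) *
      ∑ k ∈ Finset.Icc 1 n, truncMin ((incr P g Φ (2 * k + i) ω) ^ 2) p =
      avg p n (fun k => incr P g Φ ((2 * k + i - 1) + 1) ω) := by
    intro ω n
    unfold avg
    congr 1
    refine Finset.sum_congr rfl fun k hk => ?_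
    have : 2 * k + i - 1 + 1 = 2 * k + i := by
      rw [Finset.mem_Icc] at hk; omega
    beta_reduce; rw [this]
  simp only [havg]
  have hconst : ∀ F : X → ℝ, (∀ x y, F x = F y) → Continuous F := fun F hF =>
    continuous_of_const hF
  refine ⟨hconst _ fun x y => ?_, hconst _ fun x y => ?_⟩
  · have h := law_eq hP hA1 hA3 hLip hC hFam 1 p i hGm x y
    simp only [one_mul] at h
    simp only [unc_liminf_cpt _ (fun n => avg_nonneg p n _)] at h
    exact h
  · have h := law_eq hP hA1 hA3 hLip hC hFam (-1) p i hGm' x y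
    have e : ∀ ω, - liminf (fun n => (-1) * cpt (avg p n
        (fun k => incr P g Φ ((2 * k + i - 1) + 1) ω))) atTop =
        limsup (fun n => cpt (avg p n
          (fun k => incr P g Φ ((2 * k + i - 1) + 1) ω))) atTop := fun ω =>
      (limsup_eq_neg_liminf_neg _ 1 fun j => by
        simpa using abs_mul_cpt_le 1 _).symm
    simp only [e] at h
    simp only [unc_limsup_cpt _ (fun n => avg_nonneg p n _)] at h
    exact h

end
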